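/- arXiv:2104.00105 — 3 statements merged into one kernel-verified Lean document; each statement's English description precedes it below -/
import Mathlib

section
/- Let F ∈ 𝒜 and fix x₀ ∈ ℝ. Then lim_{δ→0⁺} δ·𝓗(f_δ)(δ·x₀) = 𝓗(F)(x₀). -/
open MeasureTheory

/-- `e t = e^{2πit}`. -/
noncomputable def e (t : ℝ) : ℂ := Complex.exp (2 * Real.pi * Complex.I * t)

/-- Fourier transform `F̂(t) = ∫ F(x) e^{-2πitx} dx`. -/
noncomputable def FT (F : ℝ → ℝ) (t : ℝ) : ℂ :=
  ∫ x : ℝ, (F x : ℂ) * Complex.exp (-(2 * Real.pi * Complex.I) * t * x)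

/-- Hilbert transform on `ℝ` via the multiplier `-i sgn(t)` and Fourier inversion. -/
noncomputable def HilbR (F : ℝ → ℝ) (x : ℝ) : ℂ :=
  ∫ t : ℝ, -Complex.I * (Real.sign t : ℂ) * FT F t * Complex.exp (2 * Real.pi * Complex.I * t * x)

/-- Hilbert transform on `ℝ/ℤ` of the periodization of `F_δ`, via the multiplier `-i sgn(k)`. -/
noncomputable def HilbPer (F : ℝ → ℝ) (δ : ℝ) (θ : ℝ) : ℂ :=
  ∑' k : ℤ, -Complex.I * (Int.sign k : ℂ) * FT F (δ * k) *
    Complex.exp (2 * Real.pi * Complex.I * k * θ)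

/-- The class `𝒜`: even, continuous, nonnegative, supported in `[-1/2,1/2]`, with `F̂ ∈ L¹`. -/
def memA (F : ℝ → ℝ) : Prop :=
  Continuous F ∧ (∀ x, F (-x) = F x) ∧ (∀ x, 0 ≤ F x) ∧
    (∀ x : ℝ, x ∉ Set.Icc (-(1/2) : ℝ) (1/2) → F x = 0) ∧
    MeasureTheory.Integrable (FT F)

/-- `‖𝓗(F)‖_{L^∞(ℝ)}` (sup norm of a bounded continuous function). -/
noncomputable def supHR (F : ℝ → ℝ) : ℝ := ⨆ x : ℝ, ‖HilbR F x‖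

/-- `‖𝓗(f_δ)‖_{L^∞(ℝ/ℤ)}` (sup norm of a bounded continuous function). -/
noncomputable def supHPer (F : ℝ → ℝ) (δ : ℝ) : ℝ := ⨆ θ : ℝ, ‖HilbPer F δ θ‖

/-- `𝒞(F) = max{‖𝓗(F)‖_{L∞(ℝ)}, ‖𝓗(f_F)‖_{L∞(ℝ/ℤ)}}`. -/
noncomputable def CF (F : ℝ → ℝ) : ℝ := max (supHR F) (supHPer F 1)

section Aux

open Filter FourierTransform Convolution

lemma aux_piece {g g' : ℝ → ℂ} (hd : ∀ t, HasDerivAt g (g' t) t)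
    (hg : Integrable g) (hg' : Integrable g') {a b : ℝ} (hab : a ≤ b) :
    ‖((b - a : ℝ) : ℂ) * g b - ∫ t in Set.Ioc a b, g t‖
      ≤ (b - a) * ∫ t in Set.Ioc a b, ‖g' t‖ := by
  have h1 : ((b - a : ℝ) : ℂ) * g b - ∫ t in Set.Ioc a b, g t
      = ∫ t in Set.Ioc a b, (g b - g t) := by
    rw [integral_sub (by simp) hg.integrableOn]
    simp [hab]
  rw [h1]
  have h2 : ∀ t ∈ Set.Ioc a b, ‖g b - g t‖ ≤ ∫ t in Set.Ioc a b, ‖g' t‖ := by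
    intro t ht
    rw [← intervalIntegral.integral_eq_sub_of_hasDerivAt (fun x _ => hd x)
      hg'.intervalIntegrable, intervalIntegral.integral_of_le ht.2]
    refine (norm_integral_le_integral_norm _).trans ?_
    refine setIntegral_mono_set hg'.norm.integrableOn (ae_of_all _ fun _ => norm_nonneg _) ?_
    exact (Set.Ioc_subset_Ioc_left ht.1.le).eventuallyLE
  refine (norm_setIntegral_le_of_norm_le_const (by simp) h2).trans ?_
  simp [hab, mul_comm]

lemma aux_hasSum {E : Type*} [NormedAddCommGroup E] [NormedSpace ℝ E] {g : ℝ → E}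
    (hg : Integrable g) {δ : ℝ} (hδ : 0 < δ) :
    HasSum (fun n : ℕ => ∫ t in Set.Ioc (δ * n) (δ * (n + 1)), g t) (∫ t in Set.Ioi 0, g t) := by
  have hm : Monotone (fun n : ℕ => δ * (n : ℝ)) := by
    intro a b hab
    have : (a : ℝ) ≤ b := by exact_mod_cast hab
    exact mul_le_mul_of_nonneg_left this hδ.le
  have hU : (⋃ n : ℕ, Set.Ioc (δ * (n : ℝ)) (δ * ((Order.succ n : ℕ) : ℝ))) = Set.Ioi 0 := by
    have := iUnion_Ioc_map_succ_eq_Ioi (f := fun n : ℕ => δ * (n : ℝ)) (fun a => hm bot_le) ?_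
    · simpa using this
    · apply Filter.not_bddAbove_of_tendsto_atTop (l := atTop)
      exact tendsto_natCast_atTop_atTop.const_mul_atTop hδ
  have := hasSum_integral_iUnion (f := g) (μ := volume)
    (fun n : ℕ => (measurableSet_Ioc : MeasurableSet
      (Set.Ioc (δ * (n : ℝ)) (δ * ((Order.succ n : ℕ) : ℝ)))))
    hm.pairwise_disjoint_on_Ioc_succ hg.integrableOn
  rw [hU] at this
  simpa using this

lemma aux_half {g g' : ℝ → ℂ} (hd : ∀ t, HasDerivAt g (g' t) t)
    (hg : Integrable g) (hg' : Integrable g') :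
    (∀ δ : ℝ, 0 < δ → Summable (fun n : ℕ => g (δ * (n + 1)))) ∧
    Tendsto (fun δ : ℝ => (δ : ℂ) * ∑' n : ℕ, g (δ * (n + 1)))
      (nhdsWithin 0 (Set.Ioi 0)) (nhds (∫ t in Set.Ioi 0, g t)) := by
  have key : ∀ δ : ℝ, 0 < δ → ∀ n : ℕ,
      ‖(δ : ℂ) * g (δ * (n + 1)) - ∫ t in Set.Ioc (δ * n) (δ * (n + 1)), g t‖
      ≤ δ * ∫ t in Set.Ioc (δ * n) (δ * (n + 1)), ‖g' t‖ := by
    intro δ hδ n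
    have := aux_piece hd hg hg' (a := δ * n) (b := δ * (n + 1)) (by nlinarith)
    have e1 : δ * ((n : ℝ) + 1) - δ * n = δ := by ring
    rwa [e1] at this
  have hs : ∀ δ : ℝ, 0 < δ → Summable (fun n : ℕ => g (δ * (n + 1))) := by
    intro δ hδ
    have h1 : Summable fun n : ℕ =>
        (δ : ℂ) * g (δ * (n + 1)) - ∫ t in Set.Ioc (δ * n) (δ * (n + 1)), g t :=
      Summable.of_norm_bounded ((aux_hasSum hg'.norm hδ).summable.mul_left δ) (key δ hδ)
    have h2 := h1.add (aux_hasSum hg hδ).summable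
    simp only [sub_add_cancel] at h2
    exact (summable_mul_left_iff (by exact_mod_cast hδ.ne')).1 h2
  refine ⟨hs, ?_⟩
  rw [tendsto_iff_norm_sub_tendsto_zero]
  have hlim : Tendsto (fun δ : ℝ => δ * ∫ t in Set.Ioi 0, ‖g' t‖)
      (nhdsWithin 0 (Set.Ioi 0)) (nhds 0) := by
    have : Tendsto (fun δ : ℝ => δ * ∫ t in Set.Ioi 0, ‖g' t‖) (nhds 0)
        (nhds (0 * ∫ t in Set.Ioi 0, ‖g' t‖)) := tendsto_id.mul_const _
    rw [zero_mul] at this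
    exact this.mono_left nhdsWithin_le_nhds
  refine squeeze_zero' (Eventually.of_forall fun _ => norm_nonneg _) ?_ hlim
  filter_upwards [self_mem_nhdsWithin] with δ hδ
  have hδ : 0 < δ := hδ
  have h3 := (((hs δ hδ).hasSum.mul_left (δ : ℂ)).sub (aux_hasSum hg hδ))
  rw [← h3.tsum_eq]
  exact tsum_of_norm_bounded ((aux_hasSum hg'.norm hδ).mul_left δ) (key δ hδ)

lemma FT_eq (F : ℝ → ℝ) : FT F = 𝓕 (fun x => (F x : ℂ)) := by
  ext t
  rw [FT, Real.fourier_real_eq_integral_exp_smul]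
  congr 1
  ext x
  rw [smul_eq_mul, mul_comm]
  congr 2
  push_cast
  ring

lemma aux_mul {f : ℝ → ℂ} (hc : Continuous f) (hf : Integrable f) (hf' : Integrable (𝓕 f))
    (φ : SchwartzMap ℝ ℂ) : Integrable (𝓕 (fun x => f x * φ x)) := by
  set ψ : SchwartzMap ℝ ℂ := 𝓕 φ with hψ
  set K := (𝓕 f) ⋆[ContinuousLinearMap.mul ℂ ℂ] (ψ : ℝ → ℂ) with hK
  have hKi : Integrable K := hf'.integrable_convolution _ ψ.integrable
  obtain ⟨C, hC⟩ : ∃ C, ∀ x, ‖ψ x‖ ≤ C := by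
    obtain ⟨C, hC⟩ := ψ.decay 0 0
    exact ⟨C, fun x => by simpa using hC.2 x⟩
  have hKc : Continuous K := by
    refine BddAbove.continuous_convolution_right_of_integrable _ ?_ hf' ψ.continuous
    exact ⟨C, by rintro _ ⟨x, rfl⟩; exact hC x⟩
  have hinv : 𝓕⁻ (𝓕 f) = f := hc.fourierInv_fourier_eq hf hf'
  have hinv2 : 𝓕⁻ (ψ : ℝ → ℂ) = φ := by
    rw [hψ, SchwartzMap.fourier_coe]
    exact φ.continuous.fourierInv_fourier_eq φ.integrable ψ.integrable
  have hFK : ∀ x, 𝓕 K x = f (-x) * φ (-x) := by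
    intro x
    rw [hK, Real.fourier_mul_convolution_eq hf' ψ.integrable]
    conv_rhs => rw [← hinv, ← hinv2]
    simp only [Real.fourierInv_eq_fourier_neg, neg_neg]
  have hprod : Integrable (fun x => f x * φ x) := by
    obtain ⟨D, hD⟩ := φ.decay 0 0
    have := hf.bdd_mul (c := D) φ.continuous.aestronglyMeasurable
      (ae_of_all _ fun x => by simpa using hD.2 x)
    simpa only [mul_comm] using this
  have hFKi : Integrable (𝓕 K) := by
    rw [show 𝓕 K = fun x => f (-x) * φ (-x) from funext hFK]
    exact hprod.comp_neg
  have hK2 : 𝓕⁻ K = fun x => f x * φ x := by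
    ext x
    rw [Real.fourierInv_eq_fourier_neg, hFK, neg_neg]
  rw [← hK2, hKc.fourier_fourierInv_eq hKi hFKi]
  exact hKi

lemma aux_bump : ∃ φ : SchwartzMap ℝ ℂ, ∀ x ∈ Set.Icc (-(1/2) : ℝ) (1/2),
    φ x = -2 * Real.pi * Complex.I * x := by
  obtain ⟨χ, h0, h1, h2⟩ : ∃ χ : ℝ → ℝ, HasCompactSupport χ ∧ ContDiff ℝ (⊤ : ℕ∞) χ ∧
      ∀ x ∈ Set.Icc (-(1/2) : ℝ) (1/2), χ x = 1 := by
    let χ : ContDiffBump (0 : ℝ) := ⟨1, 2, by norm_num, by norm_num⟩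
    refine ⟨χ, χ.hasCompactSupport, χ.contDiff, fun x hx => ?_⟩
    apply χ.one_of_mem_closedBall
    rw [Real.closedBall_eq_Icc]
    change x ∈ Set.Icc (0 - (1 : ℝ)) (0 + 1)
    constructor <;> linarith [hx.1, hx.2]
  have h3 : HasCompactSupport (fun x : ℝ => (-2 * Real.pi * Complex.I * x) * (χ x : ℂ)) :=
    HasCompactSupport.mul_left (f := fun x : ℝ => (-2 * Real.pi * Complex.I * x : ℂ))
      (h0.comp_left (g := fun y : ℝ => (y : ℂ)) (by simp))
  have h4 : ContDiff ℝ (⊤ : ℕ∞) (fun x : ℝ => (-2 * Real.pi * Complex.I * x) * (χ x : ℂ)) := by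
    apply ContDiff.mul
    · exact contDiff_const.mul Complex.ofRealCLM.contDiff
    · exact Complex.ofRealCLM.contDiff.comp h1
  refine ⟨h3.toSchwartzMap h4, fun x hx => ?_⟩
  change (-2 * Real.pi * Complex.I * x) * (χ x : ℂ) = _
  rw [h2 x hx]
  simp

lemma aux_FT (F : ℝ → ℝ) (hF : memA F) :
    ∃ G' : ℝ → ℂ, (∀ t, HasDerivAt (FT F) (G' t) t) ∧ Integrable G' := by
  obtain ⟨hc, -, -, hsupp, hI⟩ := hF
  rw [FT_eq] at hI ⊢
  obtain ⟨f, hf⟩ : ∃ f : ℝ → ℂ, f = fun x => (F x : ℂ) := ⟨_, rfl⟩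
  rw [← hf] at hI ⊢
  have hfc : Continuous f := by rw [hf]; fun_prop
  have hf0 : ∀ x : ℝ, x ∉ Set.Icc (-(1/2) : ℝ) (1/2) → f x = 0 := by
    intro x hx
    simp [hf, hsupp x hx]
  have hcs : HasCompactSupport f :=
    HasCompactSupport.intro (isCompact_Icc (a := (-(1/2) : ℝ)) (b := 1/2)) (fun {x} hx => hf0 x hx)
  have hfi : Integrable f := hfc.integrable_of_hasCompactSupport hcs
  have hxi : Integrable (fun x : ℝ => x • f x) :=
    (by fun_prop : Continuous (fun x : ℝ => x • f x)).integrable_of_hasCompactSupport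
      (HasCompactSupport.smul_left (f := fun x : ℝ => x) hcs)
  refine ⟨_, fun t => Real.hasDerivAt_fourier hfi hxi t, ?_⟩
  obtain ⟨φ, hφ⟩ := aux_bump
  have := aux_mul hfc hfi hI φ
  have heq : (fun x : ℝ => (-2 * Real.pi * Complex.I * x : ℂ) • f x) = fun x => f x * φ x := by
    ext x
    by_cases hx : x ∈ Set.Icc (-(1/2) : ℝ) (1/2)
    · rw [hφ x hx, smul_eq_mul, mul_comm]
    · simp [hf0 x hx]
  rw [heq]
  exact this

end Aux

open Filter in
/-- As `δ → 0⁺`, `δ·𝓗(f_δ)(δx₀) → 𝓗(F)(x₀)`. -/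
theorem stmt10 (F : ℝ → ℝ) (hF : memA F) (x₀ : ℝ) :
    Tendsto (fun δ : ℝ => (δ : ℂ) * HilbPer F δ (δ * x₀))
      (nhdsWithin 0 (Set.Ioi 0)) (nhds (HilbR F x₀)) := by
  obtain ⟨G', hG', hGi'⟩ := aux_FT F hF
  have hGi : Integrable (FT F) := hF.2.2.2.2
  set E : ℝ → ℂ := fun t => -Complex.I * Complex.exp (2 * Real.pi * Complex.I * t * x₀) with hE
  have hEc : Continuous E := by fun_prop
  have hEn : ∀ t, ‖E t‖ ≤ 1 := by
    intro t
    have : (2 * Real.pi * Complex.I * t * x₀ : ℂ) = ((2 * Real.pi * t * x₀ : ℝ) : ℂ) * Complex.I := by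
      push_cast; ring
    rw [hE]
    simp only [this, norm_mul, Complex.norm_exp_ofReal_mul_I]
    simp
  have hEd : ∀ t : ℝ, HasDerivAt E (E t * (2 * Real.pi * Complex.I * x₀)) t := by
    intro t
    have h1 : HasDerivAt (fun t : ℝ => (2 * Real.pi * Complex.I * t * x₀ : ℂ))
        (2 * Real.pi * Complex.I * x₀) t := by
      have := ((Complex.ofRealCLM.hasDerivAt (x := t)).const_mul
        (2 * Real.pi * Complex.I)).mul_const (x₀ : ℂ)
      simpa using this
    have := h1.cexp.const_mul (-Complex.I)
    exact this.congr_deriv (by simp only [hE]; ring)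
  set g : ℝ → ℂ := fun t => E t * FT F t with hg
  set g' : ℝ → ℂ := fun t => E t * (2 * Real.pi * Complex.I * x₀) * FT F t + E t * G' t with hg'
  have hgd : ∀ t, HasDerivAt g (g' t) t := fun t => (hEd t).mul (hG' t)
  have hgi : Integrable g := hGi.bdd_mul hEc.aestronglyMeasurable (ae_of_all _ hEn)
  have hgi' : Integrable g' := by
    refine Integrable.add ?_ (hGi'.bdd_mul hEc.aestronglyMeasurable (ae_of_all _ hEn))
    have := hgi.const_mul (2 * Real.pi * Complex.I * x₀)
    refine this.congr (ae_of_all _ fun t => ?_)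
    simp only [hg]; ring
  obtain ⟨hs1, ht1⟩ := aux_half hgd hgi hgi'
  have hgdn : ∀ t, HasDerivAt (fun t => g (-t)) (-g' (-t)) t := by
    intro t
    have := HasDerivAt.scomp t (hgd (-t)) (hasDerivAt_neg t)
    exact (by simpa using this : HasDerivAt (g ∘ Neg.neg) (-g' (-t)) t)
  obtain ⟨hs2, ht2⟩ := aux_half hgdn hgi.comp_neg hgi'.comp_neg.neg
  have hR : HilbR F x₀ = (∫ t in Set.Ioi 0, g t) - ∫ t in Set.Ioi 0, g (-t) := by
    have hint : HilbR F x₀ = ∫ t, (Real.sign t : ℂ) * g t := by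
      rw [HilbR]; congr 1; ext t; simp only [hg, hE]; ring
    have hsi : Integrable (fun t => (Real.sign t : ℂ) * g t) := by
      refine hgi.bdd_mul (c := 1) ?_ (ae_of_all _ fun t => ?_)
      · refine (Complex.measurable_ofReal.comp ?_).aestronglyMeasurable
        unfold Real.sign
        exact Measurable.ite measurableSet_Iio measurable_const
          (Measurable.ite measurableSet_Ioi measurable_const measurable_const)
      · rcases Real.sign_apply_eq t with h | h | h <;> simp [h]
    rw [hint, ← intervalIntegral.integral_Iic_add_Ioi hsi.integrableOn hsi.integrableOn (b := 0),
      integral_Iic_eq_integral_Iio]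
    rw [setIntegral_congr_fun (g := fun t => -g t) measurableSet_Iio
      (fun t ht => by simp [Real.sign_of_neg ht]),
      setIntegral_congr_fun (s := Set.Ioi 0) (g := fun t => g t) measurableSet_Ioi
      (fun t ht => by simp [Real.sign_of_pos ht]), integral_neg, integral_comp_neg_Ioi,
      neg_zero, integral_Iic_eq_integral_Iio]
    ring
  rw [hR]
  refine (ht1.sub ht2).congr' ?_
  filter_upwards [self_mem_nhdsWithin] with δ hδ
  rw [← mul_sub]
  congr 1
  have hterm : HilbPer F δ (δ * x₀) = ∑' k : ℤ, (Int.sign k : ℂ) * g (δ * k) := by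
    rw [HilbPer]
    congr 1
    ext k
    simp only [hg, hE]
    have : (2 * Real.pi * Complex.I * k * ((δ * x₀ : ℝ) : ℂ)) =
      2 * Real.pi * Complex.I * ((δ * k : ℝ) : ℂ) * x₀ := by push_cast; ring
    rw [this]
    ring
  have e1 : ∀ n : ℕ, ((Int.sign ((n : ℤ) + 1) : ℤ) : ℂ) * g (δ * (((n : ℤ) + 1 : ℤ) : ℝ))
      = g (δ * (n + 1)) := by
    intro n
    rw [Int.sign_eq_one_of_pos (by positivity)]
    push_cast; simp
  have e2 : ∀ n : ℕ, ((Int.sign (-((n : ℤ) + 1)) : ℤ) : ℂ) * g (δ * ((-((n : ℤ) + 1) : ℤ) : ℝ))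
      = -g (-(δ * (n + 1))) := by
    intro n
    rw [Int.sign_eq_neg_one_of_neg (by omega)]
    have : δ * ((-((n : ℤ) + 1) : ℤ) : ℝ) = -(δ * (n + 1)) := by push_cast; ring
    rw [this]; simp
  have := HasSum.of_add_one_of_neg_add_one (f := fun k : ℤ => (Int.sign k : ℂ) * g (δ * k))
    (by simp only [e1]; exact (hs1 δ hδ).hasSum) (by simp only [e2]; exact (hs2 δ hδ).hasSum.neg)
  rw [hterm, this.tsum_eq]
  simp [sub_eq_add_neg]
end

section
/- Let F ∈ 𝒜 be radial decreasing, i.e., F is nonincreasing on [0,∞). Then 𝓗(f_F)(θ) ≤ 0 for all −1/2 < θ < 0, and consequently max{‖𝓗(F)‖_{L∞(ℝ)}, ‖𝓗(f_F)‖_{L∞(ℝ/ℤ)}} = ‖𝓗(F)‖_{L∞(ℝ)}. -/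
open MeasureTheory

open Filter Topology

noncomputable def QR (ε u : ℝ) : ℝ := u / (u ^ 2 + ε ^ 2)

noncomputable def QP (ε u : ℝ) : ℝ :=
  Real.sin (2 * Real.pi * u) / (Real.cosh (2 * Real.pi * ε) - Real.cos (2 * Real.pi * u))

lemma QP_den_pos {ε : ℝ} (hε : 0 < ε) (u : ℝ) :
    0 < Real.cosh (2 * Real.pi * ε) - Real.cos (2 * Real.pi * u) := by
  have h1 : 1 < Real.cosh (2 * Real.pi * ε) :=
    Real.one_lt_cosh.2 (by positivity)
  linarith [Real.cos_le_one (2 * Real.pi * u)]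

lemma inv_re (u ε : ℝ) : (1 / ((u : ℂ) + ε * Complex.I)).re = QR ε u := by
  simp [QR, Complex.inv_re, Complex.normSq_apply, sq]

lemma QP_eq_cot {ε : ℝ} (hε : 0 < ε) (u : ℝ) :
    (Complex.cot (Real.pi * ((u : ℂ) + ε * Complex.I))).re = QP ε u := by
  have e1 : (Real.pi * ((u : ℂ) + ε * Complex.I)) =
    ((Real.pi * u : ℝ) : ℂ) + ((Real.pi * ε : ℝ) : ℂ) * Complex.I := by push_cast; ring
  have hpos := QP_den_pos hε u
  unfold QP
  rw [e1, Complex.cot, Complex.div_re, Complex.sin_add_mul_I, Complex.cos_add_mul_I]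
  rw [show 2 * Real.pi * u = 2 * (Real.pi * u) by ring,
    show 2 * Real.pi * ε = 2 * (Real.pi * ε) by ring] at *
  generalize Real.pi * u = x at *
  generalize Real.pi * ε = y at *
  have hN : ∀ a b : ℝ, Complex.normSq ((a : ℂ) + b * Complex.I) = a ^ 2 + b ^ 2 := by
    intro a b; simp [Complex.normSq_apply, sq]
  have h1 : Complex.sin x * Complex.cosh y + Complex.cos x * Complex.sinh y * Complex.I
     = ((Real.sin x * Real.cosh y : ℝ) : ℂ) + ((Real.cos x * Real.sinh y : ℝ) : ℂ) * Complex.I := by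
    push_cast; ring
  have h2 : Complex.cos x * Complex.cosh y - Complex.sin x * Complex.sinh y * Complex.I
     = ((Real.cos x * Real.cosh y : ℝ) : ℂ) + ((-(Real.sin x * Real.sinh y) : ℝ) : ℂ) * Complex.I := by
    push_cast; ring
  rw [h1, h2, hN]
  simp only [Complex.add_re, Complex.add_im, Complex.ofReal_re, Complex.ofReal_im, Complex.mul_re,
    Complex.mul_im, Complex.I_re, Complex.I_im]
  have hd : Real.cosh (2 * y) - Real.cos (2 * x) =
      2 * ((Real.sin x * Real.cosh y) ^ 2 + (Real.cos x * Real.sinh y) ^ 2) := by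
    rw [Real.cosh_two_mul, Real.cos_two_mul]
    have a1 := Real.sin_sq_add_cos_sq x
    have a2 := Real.cosh_sq y
    have a3 : Real.sin x ^ 2 = 1 - Real.cos x ^ 2 := by linarith
    rw [mul_pow, mul_pow, a3, a2]; ring
  rw [hd] at hpos ⊢
  have hne : (Real.sin x * Real.cosh y) ^ 2 + (Real.cos x * Real.sinh y) ^ 2 ≠ 0 := by
    intro h; rw [h] at hpos; simp at hpos
  rw [Real.sin_two_mul]
  have a2 := Real.cosh_sq y
  set N := (Real.sin x * Real.cosh y) ^ 2 + (Real.cos x * Real.sinh y) ^ 2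
  field_simp
  linear_combination (Real.cos x * Real.sin x) * a2

lemma mem_compl {ε : ℝ} (hε : 0 < ε) (u : ℝ) :
    ((u : ℂ) + ε * Complex.I) ∈ Complex.integerComplement := by
  rintro ⟨n, hn⟩
  have := congrArg Complex.im hn
  simp at this
  exact hε.ne this

lemma QP_hasSum {ε : ℝ} (hε : 0 < ε) (u : ℝ) :
    HasSum (fun n : ℕ => QR ε (u - (n + 1)) + QR ε (u + (n + 1))) (Real.pi * QP ε u - QR ε u) := by
  have hz := mem_compl hε u
  have h1 := cot_series_rep' hz
  have h2 := (summable_cotTerm hz).hasSum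
  have h3 : ∑' n, cotTerm ((u : ℂ) + ε * Complex.I) n =
    Real.pi * Complex.cot (Real.pi * ((u : ℂ) + ε * Complex.I)) - 1 / ((u : ℂ) + ε * Complex.I) :=
    h1.symm
  rw [h3] at h2
  have h4 := Complex.hasSum_re h2
  rw [Complex.sub_re, inv_re, Complex.re_ofReal_mul, QP_eq_cot hε] at h4
  convert h4 using 2 with n
  rw [cotTerm, Complex.add_re, ← inv_re, ← inv_re]
  push_cast
  congr 3
  · ring
  · ring

lemma QR_anti {ε v w : ℝ} (hε : 0 < ε) (hv : ε ≤ v) (hw : v ≤ w) : QR ε w ≤ QR ε v := by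
  unfold QR
  have : 0 < v := by linarith
  rw [div_le_div_iff₀ (by positivity) (by positivity)]
  have : ε ^ 2 ≤ v * w := by nlinarith
  nlinarith

lemma QR_neg (ε u : ℝ) : QR ε (-u) = - QR ε u := by
  simp [QR, neg_div]

lemma QP_neg (ε u : ℝ) : QP ε (-u) = - QP ε u := by
  simp [QP, neg_div]

lemma QP_add_one (ε u : ℝ) : QP ε (u + 1) = QP ε u := by
  simp [QP, mul_add]

/-- the comparison of the two kernels -/
lemma QP_le {ε θ y : ℝ} (hε : 0 < ε) (h0 : 0 ≤ θ) (hθ : θ + ε ≤ 1 / 2) (hy : |y| ≤ 1 / 2) :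
    Real.pi * (QP ε (θ - y) + QP ε (θ + y)) ≤ QR ε (θ - y) + QR ε (θ + y) := by
  have ha := QP_hasSum hε (θ - y)
  have hb := QP_hasSum hε (θ + y)
  have h := ha.add hb
  obtain ⟨hy1, hy2⟩ := abs_le.1 hy
  have : (Real.pi * QP ε (θ - y) - QR ε (θ - y)) + (Real.pi * QP ε (θ + y) - QR ε (θ + y)) ≤ 0 := by
    refine hasSum_le (fun n => ?_) h hasSum_zero
    have hn : (0 : ℝ) ≤ n := n.cast_nonneg
    have e1 : QR ε (θ - y - (n + 1)) = - QR ε (n + 1 - (θ - y)) := by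
      rw [← QR_neg]; congr 1; ring
    have e2 : QR ε (θ + y - (n + 1)) = - QR ε (n + 1 - (θ + y)) := by
      rw [← QR_neg]; congr 1; ring
    rw [e1, e2]
    have i1 : QR ε (θ + y + (n + 1)) ≤ QR ε (n + 1 - (θ - y)) :=
      QR_anti hε (by linarith) (by linarith)
    have i2 : QR ε (θ - y + (n + 1)) ≤ QR ε (n + 1 - (θ + y)) :=
      QR_anti hε (by linarith) (by linarith)
    linarith
  linarith

lemma QP_cont {ε : ℝ} (hε : 0 < ε) : Continuous (QP ε) := by
  unfold QP
  exact Continuous.div (by fun_prop) (by fun_prop) (fun u => (QP_den_pos hε u).ne')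

lemma QR_cont {ε : ℝ} (hε : 0 < ε) : Continuous (QR ε) := by
  unfold QR
  exact Continuous.div (by fun_prop) (by fun_prop) (fun u => by positivity)

lemma QP_int_zero (ε θ : ℝ) : ∫ y in (-(1/2) : ℝ)..(1/2), QP ε (θ - y) = 0 := by
  have hp : Function.Periodic (QP ε) 1 := QP_add_one ε
  rw [intervalIntegral.integral_comp_sub_left (QP ε) θ]
  have h1 := hp.intervalIntegral_add_eq (θ - 1/2) (-(1/2))
  rw [show θ - -(1/2) = θ - 1/2 + 1 by ring, h1]
  have h2 := intervalIntegral.integral_comp_neg (QP ε) (a := -(1/2)) (b := 1/2)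
  simp only [QP_neg, intervalIntegral.integral_neg, neg_neg] at h2
  rw [show (-(1/2) + 1 : ℝ) = 1/2 by norm_num]
  linarith

lemma exp_split (ε u t : ℝ) : Complex.exp (2 * Real.pi * Complex.I * t * u) *
    (Real.exp (-(2 * Real.pi * ε) * |t|) : ℂ) =
    Complex.exp (2 * Real.pi * Complex.I * u * t + (-(2 * Real.pi * ε) * |t| : ℝ)) := by
  rw [Complex.exp_add, Complex.ofReal_exp]; congr 2; ring

lemma kernR {ε : ℝ} (hε : 0 < ε) (u : ℝ) :
    Integrable (fun t : ℝ => -Complex.I * (Real.sign t : ℂ) *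
      (Complex.exp (2 * Real.pi * Complex.I * t * u) *
      (Real.exp (-(2 * Real.pi * ε) * |t|) : ℂ))) ∧
    ∫ t : ℝ, -Complex.I * (Real.sign t : ℂ) * (Complex.exp (2 * Real.pi * Complex.I * t * u) *
      (Real.exp (-(2 * Real.pi * ε) * |t|) : ℂ)) = ((QR ε u / Real.pi : ℝ) : ℂ) := by
  set a : ℂ := 2 * Real.pi * Complex.I * u - (2 * Real.pi * ε : ℝ) with ha
  set b : ℂ := 2 * Real.pi * Complex.I * u + (2 * Real.pi * ε : ℝ) with hb
  have hπ := Real.pi_pos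
  have hare : a.re < 0 := by simp [ha]; positivity
  have hbre : 0 < b.re := by simp [hb]; positivity
  have f1 : Set.EqOn (fun t : ℝ => -Complex.I * (Real.sign t : ℂ) *
      (Complex.exp (2 * Real.pi * Complex.I * t * u) *
      (Real.exp (-(2 * Real.pi * ε) * |t|) : ℂ))) (fun t => -Complex.I * Complex.exp (a * t))
      (Set.Ioi 0) := by
    intro t (ht : 0 < t)
    beta_reduce
    rw [exp_split, Real.sign_of_pos ht, abs_of_pos ht, ha]
    push_cast; ring_nf
  have f2 : Set.EqOn (fun t : ℝ => -Complex.I * (Real.sign t : ℂ) *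
      (Complex.exp (2 * Real.pi * Complex.I * t * u) *
      (Real.exp (-(2 * Real.pi * ε) * |t|) : ℂ))) (fun t => Complex.I * Complex.exp (b * t))
      (Set.Iio 0) := by
    intro t (ht : t < 0)
    beta_reduce
    rw [exp_split, Real.sign_of_neg ht, abs_of_neg ht, hb]
    push_cast; ring_nf
  have i1 := (integrableOn_exp_mul_complex_Ioi hare 0).const_mul (-Complex.I)
  have i2 : IntegrableOn (fun t : ℝ => Complex.I * Complex.exp (b * t)) (Set.Iio 0) :=
    ((integrableOn_exp_mul_complex_Iic hbre 0).mono_set Set.Iio_subset_Iic_self).const_mul (Complex.I)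
  have j1 := (integrableOn_congr_fun f1 measurableSet_Ioi).2 i1
  have j2 := (integrableOn_congr_fun f2 measurableSet_Iio).2 i2
  have j2' := (integrableOn_Iic_iff_integrableOn_Iio (by simp)).2 j2
  refine ⟨by simpa [Set.Iic_union_Ioi] using j2'.union j1, ?_⟩
  rw [← setIntegral_univ, ← Set.Iic_union_Ioi (a := (0 : ℝ)),
    setIntegral_union (Set.Iic_disjoint_Ioi le_rfl) measurableSet_Ioi
      j2' j1, integral_Iic_eq_integral_Iio,
    setIntegral_congr_fun measurableSet_Iio f2, setIntegral_congr_fun measurableSet_Ioi f1,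
    ← integral_Iic_eq_integral_Iio, integral_const_mul, integral_const_mul,
    integral_exp_mul_complex_Ioi hare, integral_exp_mul_complex_Iic hbre]
  have hane : a ≠ 0 := by intro h; rw [h] at hare; simp at hare
  have hbne : b ≠ 0 := by intro h; rw [h] at hbre; simp at hbre
  have hd : (u : ℂ) ^ 2 + (ε : ℂ) ^ 2 ≠ 0 := by
    norm_cast; positivity
  have hab : a * b = -(4 * Real.pi ^ 2) * ((u : ℂ) ^ 2 + (ε : ℂ) ^ 2) := by
    rw [ha, hb]; push_cast; ring_nf; rw [Complex.I_sq]; ring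
  have hsum : a + b = 4 * Real.pi * Complex.I * u := by rw [ha, hb]; push_cast; ring
  have hpc : (Real.pi : ℂ) ≠ 0 := by exact_mod_cast hπ.ne'
  have : Complex.I * (Complex.exp (b * (0 : ℝ)) / b) + -Complex.I * (-Complex.exp (a * (0 : ℝ)) / a)
     = Complex.I * (a + b) / (a * b) := by
    simp; field_simp
  rw [this, hab, hsum, QR]
  push_cast
  field_simp
  ring_nf; rw [Complex.I_sq]; ring

lemma kernP {ε : ℝ} (hε : 0 < ε) (u : ℝ) :
    HasSum (fun k : ℤ => -Complex.I * (Int.sign k : ℂ) *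
      (Complex.exp (2 * Real.pi * Complex.I * k * u) *
      (Real.exp (-(2 * Real.pi * ε) * |(k : ℝ)|) : ℂ))) (QP ε u : ℂ) := by
  set z : ℂ := (u : ℂ) + ε * Complex.I with hz
  have hzim : 0 < z.im := by simp [hz, hε]
  set q : ℂ := Complex.exp (2 * Real.pi * Complex.I * z) with hq
  have hq1 : ‖q‖ < 1 := by
    rw [hq, Complex.norm_exp]
    have hπ := Real.pi_pos
    simp [hz]
    positivity
  have hc := pi_mul_cot_pi_q_exp ⟨z, hzim⟩
  change Real.pi * Complex.cot (Real.pi * z) = Real.pi * Complex.I - 2 * Real.pi * Complex.I *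
    ∑' n : ℕ, q ^ n at hc
  have hpc : (Real.pi : ℂ) ≠ 0 := by exact_mod_cast Real.pi_pos.ne'
  have hcot : Complex.cot (Real.pi * z) = Complex.I - 2 * Complex.I * ∑' n : ℕ, q ^ n := by
    apply mul_left_cancel₀ hpc; rw [hc]; ring
  have hg := (summable_geometric_of_norm_lt_one hq1).hasSum
  rw [tsum_geometric_of_norm_lt_one hq1] at hg hcot
  have h1 : HasSum (fun n : ℕ => -Complex.I * q ^ (n + 1)) (-Complex.I * (q * (1 - q)⁻¹)) := by
    simpa [pow_succ'] using (hg.mul_left q).mul_left (-Complex.I)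
  have h2 := Complex.hasSum_conj'.2 h1
  have hval : -Complex.I * (q * (1 - q)⁻¹) + (starRingEnd ℂ) (-Complex.I * (q * (1 - q)⁻¹))
      = (QP ε u : ℂ) := by
    rw [Complex.add_conj, ← QP_eq_cot hε u, ← hz, hcot]
    have hne : 1 - q ≠ 0 := by
      intro h; have : q = 1 := by linear_combination -h
      rw [this] at hq1; simp at hq1
    have : Complex.I - 2 * Complex.I * (1 - q)⁻¹ = 2 * (-Complex.I * (q * (1 - q)⁻¹)) - Complex.I := by
      field_simp; ring
    rw [this, Complex.sub_re, Complex.I_re, sub_zero]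
    norm_num
    ring
  rw [← hval]
  have key := HasSum.of_add_one_of_neg_add_one (f := fun k : ℤ => -Complex.I * (Int.sign k : ℂ) *
      (Complex.exp (2 * Real.pi * Complex.I * k * u) *
      (Real.exp (-(2 * Real.pi * ε) * |(k : ℝ)|) : ℂ))) (m := -Complex.I * (q * (1 - q)⁻¹))
      (m' := (starRingEnd ℂ) (-Complex.I * (q * (1 - q)⁻¹))) ?_ ?_
  · simpa only [Int.sign_zero, Int.cast_zero, mul_zero, zero_mul, add_zero] using key
  · convert h1 using 2 with n
    have hs : Int.sign ((n : ℤ) + 1) = 1 := Int.sign_eq_one_of_pos (by positivity)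
    have h := exp_split ε u ((n : ℝ) + 1)
    push_cast at h ⊢
    rw [hs, h, hq, ← Complex.exp_nat_mul, abs_of_pos (by positivity), hz]
    push_cast
    rw [mul_one]
    congr 2
    linear_combination (-2 * Real.pi * ε * (n + 1)) * Complex.I_sq
  · convert h2 using 2 with n
    have hs : Int.sign (-((n : ℤ) + 1)) = -1 := Int.sign_eq_neg_one_of_neg (by linarith)
    have h := exp_split ε u (-((n : ℝ) + 1))
    push_cast at h ⊢
    rw [hs, h, hq, ← Complex.exp_nat_mul, abs_neg, abs_of_pos (by positivity), hz]
    simp only [map_mul, map_neg, Complex.conj_I, ← Complex.exp_conj, map_add, Complex.conj_ofReal,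
      map_natCast, map_ofNat]
    push_cast
    rw [mul_neg_one]
    congr 2
    linear_combination (-2 * Real.pi * ε * (n + 1)) * Complex.I_sq

lemma sign_meas : Measurable Real.sign := by
  unfold Real.sign
  exact Measurable.ite measurableSet_Iio measurable_const
    (Measurable.ite measurableSet_Ioi measurable_const measurable_const)

lemma memA_integrable {F : ℝ → ℝ} (hF : memA F) {K : ℝ → ℝ} (hK : Continuous K) :
    Integrable (fun y => F y * K y) := by
  obtain ⟨hc, -, -, hs, -⟩ := hF
  refine Continuous.integrable_of_hasCompactSupport (by fun_prop) ?_
  refine HasCompactSupport.intro (K := Set.Icc (-(1/2)) (1/2)) isCompact_Icc ?_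
  intro x hx
  rw [hs x hx, zero_mul]

lemma memA_int {F : ℝ → ℝ} (hF : memA F) : Integrable F := by
  simpa using memA_integrable hF (K := fun _ => 1) continuous_const

lemma norm_e (t x : ℝ) : ‖Complex.exp (2 * Real.pi * Complex.I * t * x)‖ = 1 := by
  rw [Complex.norm_exp]; simp

lemma norm_e' (t x : ℝ) : ‖Complex.exp (-(2 * Real.pi * Complex.I) * t * x)‖ = 1 := by
  rw [Complex.norm_exp]; simp

lemma abelP {F : ℝ → ℝ} (hF : memA F) {ε : ℝ} (hε : 0 < ε) (θ : ℝ) :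
    ∑' k : ℤ, -Complex.I * (Int.sign k : ℂ) * FT F (1 * k) *
      Complex.exp (2 * Real.pi * Complex.I * k * θ) * (Real.exp (-(2 * Real.pi * ε) * |(k : ℝ)|) : ℂ)
     = ((∫ y, F y * QP ε (θ - y) : ℝ) : ℂ) := by
  let N : ℤ → ℝ → ℂ := fun k u => -Complex.I * (Int.sign k : ℂ) *
      (Complex.exp (2 * Real.pi * Complex.I * k * u) *
      (Real.exp (-(2 * Real.pi * ε) * |(k : ℝ)|) : ℂ))
  have hN : ∀ u, HasSum (fun k => N k u) (QP ε u : ℂ) := kernP hε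
  have hnorm : ∀ k u, ‖N k u‖ = ‖N k 0‖ := by
    intro k u
    have a1 := norm_e k u
    have a2 := norm_e k 0
    simp only [Complex.ofReal_intCast] at a1 a2
    simp only [N, norm_mul, a1, a2]
  have hFi : Integrable (fun y => (F y : ℂ)) := (memA_int hF).ofReal
  have hcont : ∀ k, Continuous (fun y : ℝ => N k (θ - y)) := by
    intro k; simp only [N]; fun_prop
  have h1 : ∀ k, Integrable (fun y => (F y : ℂ) * N k (θ - y)) := by
    intro k
    exact hFi.mul_bdd (c := ‖N k 0‖) (hcont k).aestronglyMeasurable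
      (Eventually.of_forall fun y => (hnorm k _).le)
  have h2 : Summable fun k => ∫ y, ‖(F y : ℂ) * N k (θ - y)‖ := by
    simp only [norm_mul, hnorm _ (θ - _), integral_mul_const]
    exact (hN 0).summable.norm.mul_left _
  have h3 := (hasSum_integral_of_summable_integral_norm h1 h2).tsum_eq
  have h4 : ∀ y, ∑' k, (F y : ℂ) * N k (θ - y) = ((F y * QP ε (θ - y) : ℝ) : ℂ) := by
    intro y
    rw [tsum_mul_left, (hN _).tsum_eq]; push_cast; rfl
  simp only [h4, integral_complex_ofReal] at h3
  refine Eq.trans (tsum_congr fun k => ?_) h3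
  rw [FT, mul_assoc, mul_assoc, mul_comm (∫ x : ℝ, _), ← mul_assoc, ← integral_const_mul]
  congr 1; ext y
  simp only [N]
  have : Complex.exp (2 * Real.pi * Complex.I * k * ((θ - y : ℝ) : ℂ)) =
    Complex.exp (2 * Real.pi * Complex.I * k * θ) *
      Complex.exp (-(2 * Real.pi * Complex.I) * ((1 * k : ℝ) : ℂ) * y) := by
    rw [← Complex.exp_add]; congr 1; push_cast; ring
  rw [this]; ring

lemma abelR {F : ℝ → ℝ} (hF : memA F) {ε : ℝ} (hε : 0 < ε) (x : ℝ) :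
    ∫ t : ℝ, -Complex.I * (Real.sign t : ℂ) * FT F t *
      Complex.exp (2 * Real.pi * Complex.I * t * x) * (Real.exp (-(2 * Real.pi * ε) * |t|) : ℂ)
     = ((∫ y, F y * (QR ε (x - y) / Real.pi) : ℝ) : ℂ) := by
  let N : ℝ → ℝ → ℂ := fun t u => -Complex.I * (Real.sign t : ℂ) *
      (Complex.exp (2 * Real.pi * Complex.I * t * u) *
      (Real.exp (-(2 * Real.pi * ε) * |t|) : ℂ))
  have hN : ∀ u, ∫ t, N t u = ((QR ε u / Real.pi : ℝ) : ℂ) := fun u => (kernR hε u).2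
  have hNi : Integrable (fun t => N t x) := (kernR hε x).1
  have hFi : Integrable (fun y => (F y : ℂ)) := (memA_int hF).ofReal
  have hsplit : ∀ t y : ℝ, N t (x - y) = N t x *
      Complex.exp (-(2 * Real.pi * Complex.I) * t * y) := by
    intro t y
    have : Complex.exp (2 * Real.pi * Complex.I * t * ((x - y : ℝ) : ℂ)) =
      Complex.exp (2 * Real.pi * Complex.I * t * x) *
        Complex.exp (-(2 * Real.pi * Complex.I) * t * y) := by
      rw [← Complex.exp_add]; congr 1; push_cast; ring
    simp only [N, this]; ring
  have hprod : Integrable (Function.uncurry fun t y : ℝ => (F y : ℂ) * N t (x - y))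
      (volume.prod volume) := by
    have h := (hNi.mul_prod hFi).mul_bdd (c := 1)
      (g := fun p : ℝ × ℝ => Complex.exp (-(2 * Real.pi * Complex.I) * p.1 * p.2))
      (Continuous.aestronglyMeasurable (by fun_prop))
      (Eventually.of_forall fun p => (norm_e' _ _).le)
    refine h.congr (Eventually.of_forall fun p => ?_)
    simp only [Function.uncurry, hsplit]; ring
  have h3 := integral_integral_swap hprod
  simp only [integral_const_mul, hN] at h3
  rw [← integral_complex_ofReal]
  push_cast at h3 ⊢
  rw [← h3]
  congr 1; ext t
  rw [FT, mul_assoc, mul_assoc, mul_comm (∫ x : ℝ, _), ← mul_assoc, ← integral_const_mul]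
  congr 1; ext y
  rw [hsplit]; simp only [N]; push_cast; ring

lemma exp_tend (c : ℝ) : Tendsto (fun ε : ℝ => (Real.exp (-(2 * Real.pi * ε) * |c|) : ℂ))
    (𝓝[>] 0) (𝓝 1) := by
  have h : Continuous (fun ε : ℝ => (Real.exp (-(2 * Real.pi * ε) * |c|) : ℂ)) := by fun_prop
  have := (h.tendsto 0).mono_left (nhdsWithin_le_nhds (s := Set.Ioi 0))
  simpa using this

lemma exp_le' {ε : ℝ} (hε : 0 < ε) (c : ℝ) : ‖(Real.exp (-(2 * Real.pi * ε) * |c|) : ℂ)‖ ≤ 1 := by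
  rw [Complex.norm_real, Real.norm_eq_abs, Real.abs_exp, Real.exp_le_one_iff]
  have : 0 ≤ 2 * Real.pi * ε * |c| := by have := Real.pi_pos; positivity
  linarith

lemma limP {F : ℝ → ℝ} (hF : memA F) (θ : ℝ)
    (hs : Summable fun k : ℤ => -Complex.I * (Int.sign k : ℂ) * FT F (1 * k) *
      Complex.exp (2 * Real.pi * Complex.I * k * θ)) :
    Tendsto (fun ε => ((∫ y, F y * QP ε (θ - y) : ℝ) : ℂ)) (𝓝[>] 0) (𝓝 (HilbPer F 1 θ)) := by
  have h := tendsto_tsum_of_dominated_convergence (𝓕 := 𝓝[>] (0:ℝ)) (f := fun (ε : ℝ) (k : ℤ) =>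
      -Complex.I * (Int.sign k : ℂ) * FT F (1 * k) *
      Complex.exp (2 * Real.pi * Complex.I * k * θ) * (Real.exp (-(2 * Real.pi * ε) * |(k : ℝ)|) : ℂ))
      (g := fun k : ℤ => -Complex.I * (Int.sign k : ℂ) * FT F (1 * k) *
      Complex.exp (2 * Real.pi * Complex.I * k * θ))
      hs.norm (fun k => by
        have := (exp_tend k).const_mul (-Complex.I * (Int.sign k : ℂ) * FT F (1 * k) *
          Complex.exp (2 * Real.pi * Complex.I * k * θ))
        rwa [mul_one] at this) ?_
  · refine Tendsto.congr' ?_ h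
    filter_upwards [self_mem_nhdsWithin] with ε hε
    exact abelP hF hε θ
  · filter_upwards [self_mem_nhdsWithin] with ε hε k
    rw [norm_mul]
    exact mul_le_of_le_one_right (norm_nonneg _) (exp_le' hε _)

lemma HilbR_int {F : ℝ → ℝ} (hF : memA F) (x : ℝ) : Integrable (fun t : ℝ =>
      -Complex.I * (Real.sign t : ℂ) * FT F t * Complex.exp (2 * Real.pi * Complex.I * t * x)) ∧
      ∀ t : ℝ, ‖-Complex.I * (Real.sign t : ℂ) * FT F t *
        Complex.exp (2 * Real.pi * Complex.I * t * x)‖ ≤ ‖FT F t‖ := by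
  have hi := hF.2.2.2.2
  have hb : ∀ t : ℝ, ‖-Complex.I * (Real.sign t : ℂ) * FT F t *
        Complex.exp (2 * Real.pi * Complex.I * t * x)‖ ≤ ‖FT F t‖ := by
    intro t
    rw [norm_mul, norm_mul, norm_mul, norm_e, norm_neg, Complex.norm_I, one_mul, mul_one]
    refine mul_le_of_le_one_left (norm_nonneg _) ?_
    rcases Real.sign_apply_eq t with h | h | h <;> simp [h]
  refine ⟨?_, hb⟩
  refine hi.norm.mono' ?_ (Eventually.of_forall hb)
  refine AEStronglyMeasurable.mul (AEStronglyMeasurable.mul ?_ hi.1)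
    (Continuous.aestronglyMeasurable (by fun_prop))
  exact ((Complex.measurable_ofReal.comp sign_meas).const_mul _).aestronglyMeasurable

lemma limR {F : ℝ → ℝ} (hF : memA F) (x : ℝ) :
    Tendsto (fun ε => ((∫ y, F y * (QR ε (x - y) / Real.pi) : ℝ) : ℂ)) (𝓝[>] 0)
      (𝓝 (HilbR F x)) := by
  obtain ⟨h1, h2⟩ := HilbR_int hF x
  have h := tendsto_integral_filter_of_dominated_convergence (l := 𝓝[>] (0:ℝ)) (μ := volume)
      (F := fun (ε : ℝ) (t : ℝ) => -Complex.I * (Real.sign t : ℂ) * FT F t *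
      Complex.exp (2 * Real.pi * Complex.I * t * x) * (Real.exp (-(2 * Real.pi * ε) * |t|) : ℂ))
      (f := fun t : ℝ => -Complex.I * (Real.sign t : ℂ) * FT F t *
      Complex.exp (2 * Real.pi * Complex.I * t * x))
      (fun t => ‖FT F t‖) ?_ ?_ hF.2.2.2.2.norm
      (Eventually.of_forall fun t => by simpa using (exp_tend t).const_mul _)
  · refine Tendsto.congr' ?_ h
    filter_upwards [self_mem_nhdsWithin] with ε hε
    exact abelR hF hε x
  · exact Eventually.of_forall fun ε => h1.1.mul (Continuous.aestronglyMeasurable (by fun_prop))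
  · filter_upwards [self_mem_nhdsWithin] with ε hε
    refine Eventually.of_forall fun t => ?_
    rw [norm_mul]
    exact (mul_le_of_le_one_right (norm_nonneg _) (exp_le' hε _)).trans (h2 t)

lemma bddR {F : ℝ → ℝ} (hF : memA F) : BddAbove (Set.range fun x => ‖HilbR F x‖) := by
  refine ⟨∫ t, ‖FT F t‖, ?_⟩
  rintro _ ⟨x, rfl⟩
  obtain ⟨h1, h2⟩ := HilbR_int hF x
  exact norm_integral_le_of_norm_le hF.2.2.2.2.norm (Eventually.of_forall h2)

lemma symm_int {F : ℝ → ℝ} (hF : memA F) {K : ℝ → ℝ} (hK : Continuous K) (θ : ℝ) :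
    2 * ∫ y, F y * K (θ - y) = ∫ y, F y * (K (θ - y) + K (θ + y)) := by
  have h1 : ∫ y, F y * K (θ + y) = ∫ y, F y * K (θ - y) := by
    rw [← integral_neg_eq_self]
    congr 1; ext y; rw [hF.2.1, sub_eq_add_neg]
  simp only [mul_add]
  rw [integral_add (memA_integrable hF (by fun_prop)) (memA_integrable hF (by fun_prop)), h1]
  ring

lemma QP_QR_compare {F : ℝ → ℝ} (hF : memA F) {ε θ : ℝ} (hε : 0 < ε) (h0 : 0 ≤ θ) (hθ : θ + ε ≤ 1 / 2) :
    ∫ y, F y * QP ε (θ - y) ≤ ∫ y, F y * (QR ε (θ - y) / Real.pi) := by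
  have hP := QP_cont hε
  have hR := (QR_cont hε).div_const Real.pi
  have h1 := symm_int hF hP θ
  have h2 := symm_int hF hR θ
  have hπ := Real.pi_pos
  have : ∫ y, F y * (QP ε (θ - y) + QP ε (θ + y)) ≤
      ∫ y, F y * (QR ε (θ - y) / Real.pi + QR ε (θ + y) / Real.pi) := by
    refine integral_mono (memA_integrable hF (by fun_prop)) (memA_integrable hF
      (K := fun y => (QR ε (θ - y) / Real.pi + QR ε (θ + y) / Real.pi))
      ((hR.comp (by fun_prop : Continuous fun y : ℝ => θ - y)).add
      (hR.comp (by fun_prop : Continuous fun y : ℝ => θ + y)))) ?_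
    intro y
    by_cases hy : y ∈ Set.Icc (-(1/2) : ℝ) (1/2)
    · refine mul_le_mul_of_nonneg_left ?_ (hF.2.2.1 y)
      rw [← add_div, le_div_iff₀ hπ, mul_comm]
      exact QP_le hε h0 hθ (abs_le.2 hy)
    · simp [hF.2.2.2.1 y hy]
  linarith

lemma nonnegP {F : ℝ → ℝ} (hF : memA F) (hdec : ∀ x y : ℝ, 0 ≤ x → x ≤ y → F y ≤ F x)
    {ε θ : ℝ} (hε : 0 < ε) (h0 : 0 ≤ θ) (hθ : θ ≤ 1 / 2) :
    0 ≤ ∫ y, F y * QP ε (θ - y) := by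
  have hπ := Real.pi_pos
  have hP := QP_cont hε
  have h1 := symm_int hF hP θ
  set S : ℝ → ℝ := fun y => QP ε (θ - y) + QP ε (θ + y) with hS
  have hSc : Continuous S := by fun_prop
  have hSint : ∫ y in (-(1/2) : ℝ)..(1/2), S y = 0 := by
    rw [hS, intervalIntegral.integral_add (Continuous.intervalIntegrable (by fun_prop) _ _)
      (Continuous.intervalIntegrable (by fun_prop) _ _), QP_int_zero]
    have h2 := intervalIntegral.integral_comp_neg (fun y => QP ε (θ - y)) (a := -(1/2)) (b := 1/2)
    simp only [sub_neg_eq_add, neg_neg, QP_int_zero] at h2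
    rw [h2, zero_add]
  set C := Real.cosh (2 * Real.pi * ε) with hC
  have hC1 : 1 < C := Real.one_lt_cosh.2 (by positivity)
  -- the sign change
  set c := Real.cos (2 * Real.pi * θ) / C with hc
  have hcl : -1 ≤ c := by
    rw [hc, le_div_iff₀ (by linarith)]
    linarith [Real.neg_one_le_cos (2 * Real.pi * θ)]
  have hcu : c ≤ 1 := by
    rw [hc, div_le_iff₀ (by linarith)]
    linarith [Real.cos_le_one (2 * Real.pi * θ)]
  set a := Real.arccos c with ha
  have hSf : ∀ y, ∃ w, 0 ≤ w ∧ S y = w * (Real.cos (2 * Real.pi * y) - c) := by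
    intro y
    have d1 := QP_den_pos hε (θ - y)
    have d2 := QP_den_pos hε (θ + y)
    have hs : 0 ≤ Real.sin (2 * Real.pi * θ) := by
      apply Real.sin_nonneg_of_nonneg_of_le_pi (by positivity)
      nlinarith
    refine ⟨2 * Real.sin (2 * Real.pi * θ) * C / ((C - Real.cos (2 * Real.pi * (θ - y))) *
      (C - Real.cos (2 * Real.pi * (θ + y)))), by positivity, ?_⟩
    simp only [hS, QP, ← hC]
    rw [div_add_div _ _ d1.ne' d2.ne', div_mul_eq_mul_div]
    congr 1
    have : C * c = Real.cos (2 * Real.pi * θ) := by rw [hc]; field_simp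
    rw [← hC, show 2 * Real.pi * (θ - y) = 2 * Real.pi * θ - 2 * Real.pi * y by ring,
      show 2 * Real.pi * (θ + y) = 2 * Real.pi * θ + 2 * Real.pi * y by ring,
      Real.sin_sub, Real.sin_add, Real.cos_sub, Real.cos_add]
    have e1 := Real.sin_sq_add_cos_sq (2 * Real.pi * y)
    linear_combination (-2 * Real.sin (2 * Real.pi * θ) * Real.cos (2 * Real.pi * θ)) * e1 +
      2 * Real.sin (2 * Real.pi * θ) * this
  set ys := a / (2 * Real.pi) with hys
  have hays : a = 2 * Real.pi * ys := by rw [hys]; field_simp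
  have hys0 : 0 ≤ ys := by have := Real.arccos_nonneg c; positivity
  have hpt : ∀ y ∈ Set.Icc (-(1/2) : ℝ) (1/2), F ys * S y ≤ F y * S y := by
    intro y hy
    obtain ⟨w, hw, e⟩ := hSf y
    rw [e]
    have hFa : F y = F |y| := by
      rcases abs_choice y with h | h <;> rw [h]
      rw [hF.2.1]
    have hca : Real.cos (2 * Real.pi * y) = Real.cos (2 * Real.pi * |y|) := by
      rcases abs_choice y with h | h <;> rw [h]
      rw [mul_neg, Real.cos_neg]
    have hy' : |y| ≤ 1/2 := abs_le.2 hy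
    have hy0 := abs_nonneg y
    rw [hFa, hca]
    have hcc : c = Real.cos (2 * Real.pi * ys) := by rw [← hays, ha, Real.cos_arccos hcl hcu]
    have hyspi : 2 * Real.pi * ys ≤ Real.pi := by rw [← hays]; exact Real.arccos_le_pi c
    rcases le_total |y| ys with h | h
    · have f1 := hdec _ _ hy0 h
      have f2 : c ≤ Real.cos (2 * Real.pi * |y|) := by
        rw [hcc]
        exact Real.cos_le_cos_of_nonneg_of_le_pi (by positivity) hyspi (by gcongr)
      exact mul_le_mul_of_nonneg_right f1 (mul_nonneg hw (by linarith))
    · have f1 := hdec _ _ hys0 h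
      have f2 : Real.cos (2 * Real.pi * |y|) ≤ c := by
        rw [hcc]
        exact Real.cos_le_cos_of_nonneg_of_le_pi (by positivity) (by nlinarith) (by gcongr)
      exact mul_le_mul_of_nonpos_right f1 (mul_nonpos_of_nonneg_of_nonpos hw (by linarith))
  have hres : ∫ y, F y * S y = ∫ y in (-(1/2) : ℝ)..(1/2), F y * S y := by
    rw [intervalIntegral.integral_of_le (by norm_num), ← integral_Icc_eq_integral_Ioc,
      setIntegral_eq_integral_of_forall_compl_eq_zero]
    intro y hy; rw [hF.2.2.2.1 y hy, zero_mul]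
  have hmono := intervalIntegral.integral_mono_on (by norm_num : (-(1/2) : ℝ) ≤ 1/2)
    (Continuous.intervalIntegrable (μ := volume) (by fun_prop : Continuous fun y => F ys * S y) _ _)
    (Continuous.intervalIntegrable (μ := volume) (hF.1.mul hSc) _ _) hpt
  rw [intervalIntegral.integral_const_mul, hSint, mul_zero] at hmono
  have : (0 : ℝ) ≤ ∫ y, F y * S y := by rw [hres]; exact hmono
  linarith

lemma FT_neg {F : ℝ → ℝ} (hF : memA F) (t : ℝ) : FT F (-t) = FT F t := by
  unfold FT
  rw [← integral_neg_eq_self]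
  congr 1; ext x; rw [hF.2.1]; push_cast; ring_nf

lemma HP_neg {F : ℝ → ℝ} (hF : memA F) (θ : ℝ) : HilbPer F 1 (-θ) = - HilbPer F 1 θ := by
  unfold HilbPer
  rw [← (Equiv.neg ℤ).tsum_eq, ← tsum_neg]
  congr 1; ext k
  have := FT_neg hF k
  simp only [Equiv.neg_apply, Int.sign_neg, Int.cast_neg, one_mul, Complex.ofReal_neg, this]
  ring_nf

lemma HP_periodic (F : ℝ → ℝ) : Function.Periodic (HilbPer F 1) 1 := by
  intro θ
  unfold HilbPer
  congr 1; ext k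
  congr 1
  rw [Complex.exp_eq_exp_iff_exists_int]
  exact ⟨k, by push_cast; ring⟩

/-- the main pointwise facts -/
lemma HP_main {F : ℝ → ℝ} (hF : memA F) (hdec : ∀ x y : ℝ, 0 ≤ x → x ≤ y → F y ≤ F x)
    {θ : ℝ} (h0 : 0 ≤ θ) (hθ : θ < 1 / 2) :
    0 ≤ (HilbPer F 1 θ).re ∧ (HilbPer F 1 θ).im = 0 ∧ ‖HilbPer F 1 θ‖ ≤ ‖HilbR F θ‖ := by
  by_cases hs : Summable fun k : ℤ => -Complex.I * (Int.sign k : ℂ) * FT F (1 * k) *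
      Complex.exp (2 * Real.pi * Complex.I * k * θ)
  · have hP := limP hF θ hs
    have hR := limR hF θ
    have hPr := (Complex.continuous_re.tendsto _).comp hP
    have hPi := (Complex.continuous_im.tendsto _).comp hP
    have hRr := (Complex.continuous_re.tendsto _).comp hR
    have hre : 0 ≤ (HilbPer F 1 θ).re := by
      refine ge_of_tendsto hPr ?_
      filter_upwards [self_mem_nhdsWithin] with ε hε
      exact nonnegP hF hdec hε h0 hθ.le
    have him : (HilbPer F 1 θ).im = 0 := by
      refine tendsto_nhds_unique hPi ?_
      exact tendsto_const_nhds.congr fun ε => (Complex.ofReal_im _).symm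
    have hle : (HilbPer F 1 θ).re ≤ (HilbR F θ).re := by
      refine le_of_tendsto_of_tendsto hPr hRr ?_
      filter_upwards [Ioo_mem_nhdsGT (show (0 : ℝ) < 1 / 2 - θ by linarith)] with ε hε
      exact QP_QR_compare hF hε.1 h0 (by linarith [hε.2])
    refine ⟨hre, him, ?_⟩
    have : HilbPer F 1 θ = ((HilbPer F 1 θ).re : ℂ) := Complex.ext (by simp) (by simp [him])
    rw [this, Complex.norm_real, Real.norm_of_nonneg hre]
    exact hle.trans (Complex.re_le_norm _)
  · have : HilbPer F 1 θ = 0 := tsum_eq_zero_of_not_summable hs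
    simp [this]

/-- If `F ∈ 𝒜` is radial decreasing, then `𝓗(f_F) ≤ 0` on `(-1/2, 0)` and consequently
`max{‖𝓗(F)‖_{L∞(ℝ)}, ‖𝓗(f_F)‖_{L∞(ℝ/ℤ)}} = ‖𝓗(F)‖_{L∞(ℝ)}`. -/
theorem stmt11 (F : ℝ → ℝ) (hF : memA F)
    (hdec : ∀ x y : ℝ, 0 ≤ x → x ≤ y → F y ≤ F x) :
    (∀ θ : ℝ, -(1/2) < θ → θ < 0 →
      (HilbPer F 1 θ).re ≤ 0 ∧ (HilbPer F 1 θ).im = 0) ∧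
    max (supHR F) (supHPer F 1) = supHR F := by
  refine ⟨?_, ?_⟩
  · intro θ h1 h2
    obtain ⟨a, b, -⟩ := HP_main hF hdec (θ := -θ) (by linarith) (by linarith)
    rw [HP_neg hF] at a b
    simp only [Complex.neg_re, Complex.neg_im] at a b
    exact ⟨by linarith, by linarith⟩
  · apply max_eq_left
    have hle : ∀ x, ‖HilbR F x‖ ≤ supHR F := fun x => le_ciSup (bddR hF) x
    refine ciSup_le fun θ => ?_
    have key : ∀ θ, 0 ≤ θ → θ ≤ 1 / 2 → ‖HilbPer F 1 θ‖ ≤ supHR F := by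
      intro θ h0 h1
      rcases h1.lt_or_eq with h | h
      · exact (HP_main hF hdec h0 h).2.2.trans (hle θ)
      · have e1 := HP_neg hF θ
        have e2 := HP_periodic F (-θ)
        rw [show -θ + 1 = θ by linarith] at e2
        have : HilbPer F 1 θ = 0 := by
          rw [← e2] at e1
          exact self_eq_neg.1 e1
        rw [this, norm_zero]
        exact (norm_nonneg _).trans (hle 0)
    have e : HilbPer F 1 θ = HilbPer F 1 (θ - round θ) := by
      have := (HP_periodic F).sub_int_mul_eq (round θ) (x := θ)
      rw [mul_one] at this; exact this.symm
    rw [e]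
    have hr := abs_le.1 (abs_sub_round θ)
    rcases le_total 0 (θ - round θ) with h | h
    · exact key _ h hr.2
    · rw [← neg_neg (θ - round θ), HP_neg hF, norm_neg]
      exact key _ (by linarith) (by linarith [hr.1])
end

section
/- Let 𝔉(x) = (2/π)·log((1 + √(1 − 4x²))/(2|x|)) for 0 < |x| ≤ 1/2 and 𝔉(x) = 0 for |x| > 1/2. Then 𝔉 ≥ 0, ∫_ℝ 𝔉(x) dx = 1, and for every x ∉ {0, 1/2, −1/2} the principal value limit defining 𝓗(𝔉)(x) exists and equals sgn(x) if 0 < |x| < 1/2, and (2/π)·arcsin(1/(2x)) if |x| > 1/2. In particular the (essential) supremum of |𝓗(𝔉)| over ℝ equals 1. -/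
open MeasureTheory Filter

/-- The principal-value Hilbert transform of `F` at `x` exists and equals `L`:
`𝓗(F)(x) = lim_{ε→0⁺} (1/π)·∫_{|t|≥ε} F(x−t)/t dt`. -/
def pvHilbAt (F : ℝ → ℝ) (x L : ℝ) : Prop :=
  Tendsto (fun ε : ℝ => (1 / Real.pi) * ∫ t in {t : ℝ | ε ≤ |t|}, F (x - t) / t)
    (nhdsWithin 0 (Set.Ioi 0)) (nhds L)

/-- The class `𝒜*`: `F ∈ L¹(ℝ)`, `F ≥ 0` a.e., support contained in `[-1/2,1/2]`. -/
def memAstar (F : ℝ → ℝ) : Prop :=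
  Integrable F ∧ (∀ᵐ x ∂(volume : Measure ℝ), 0 ≤ F x) ∧
    ∀ᵐ x ∂(volume : Measure ℝ), x ∉ Set.Icc (-(1/2) : ℝ) (1/2) → F x = 0

/-- The magic even function `𝔉(x) = (2/π)·log((1 + √(1 − 4x²))/(2|x|))` for `0 < |x| ≤ 1/2`,
and `0` for `|x| > 1/2`. -/
noncomputable def frakF (x : ℝ) : ℝ :=
  if 0 < |x| ∧ |x| ≤ 1/2 then
    (2 / Real.pi) * Real.log ((1 + Real.sqrt (1 - 4 * x ^ 2)) / (2 * |x|))
  else 0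

/-- The change of variables `w ↦ w / (1 + w²)`. -/
noncomputable def yy (w : ℝ) : ℝ := w / (1 + w ^ 2)

/-- The kernel representing `frakF`. -/
noncomputable def kk (y w : ℝ) : ℝ := if |y| ≤ yy w then w⁻¹ else 0

lemma yy_pos {w : ℝ} (hw : 0 < w) : 0 < yy w := by unfold yy; positivity

lemma yy_le (w : ℝ) : yy w ≤ 1/2 := by
  unfold yy
  rw [div_le_div_iff₀ (by positivity) (by norm_num)]
  nlinarith [sq_nonneg (w - 1)]

lemma exists_r {u : ℝ} (hu : 0 < u) (hu2 : u ≤ 1/2) :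
    ∃ r : ℝ, 0 < r ∧ r ≤ 1 ∧ u = yy r ∧ (1 + Real.sqrt (1 - 4 * u ^ 2)) / (2 * u) = 1 / r := by
  set s := Real.sqrt (1 - 4 * u ^ 2) with hs
  have h0 : 0 ≤ 1 - 4 * u ^ 2 := by nlinarith
  have hss : s ^ 2 = 1 - 4 * u ^ 2 := Real.sq_sqrt h0
  have hs0 : 0 ≤ s := Real.sqrt_nonneg _
  have hs1 : s < 1 := by nlinarith
  refine ⟨2 * u / (1 + s), by positivity, ?_, ?_, ?_⟩
  · rw [div_le_one (by positivity)]; linarith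
  · unfold yy
    have : 1 + (2 * u / (1 + s)) ^ 2 = 2 / (1 + s) := by
      field_simp
      nlinarith
    rw [this]
    field_simp
  · rw [one_div_div]

lemma yy_le_iff {r w : ℝ} (hr : 0 < r) (hr1 : r ≤ 1) (hw : 0 < w) (hw1 : w < 1) :
    yy r ≤ yy w ↔ r ≤ w := by
  unfold yy
  rw [div_le_div_iff₀ (by positivity) (by positivity)]
  have h : r * (1 + w ^ 2) - w * (1 + r ^ 2) = (r - w) * (1 - r * w) := by ring
  have h1 : 0 < 1 - r * w := by nlinarith
  constructor
  · intro h2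
    by_contra h3
    push Not at h3
    have := mul_pos (sub_pos.2 h3) h1
    linarith
  · intro h2
    have := mul_nonneg (sub_nonneg.2 h2) h1.le
    linarith

lemma frakF_rep {y : ℝ} (hy : y ≠ 0) :
    frakF y = (2 / Real.pi) * ∫ w in Set.Ioo (0:ℝ) 1, kk y w := by
  have hy0 : 0 < |y| := abs_pos.2 hy
  unfold frakF
  split_ifs with h
  · obtain ⟨r, hr, hr1, hur, hl⟩ := exists_r hy0 h.2
    rw [sq_abs] at hl
    rw [hl]
    congr 1
    have h1 : ∀ w ∈ Set.Ioo (0:ℝ) 1, kk y w = (Set.Ico r 1).indicator (fun w => w⁻¹) w := by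
      intro w hw
      unfold kk
      rw [hur]
      by_cases h : r ≤ w
      · rw [if_pos ((yy_le_iff hr hr1 hw.1 hw.2).2 h), 
          Set.indicator_of_mem (show w ∈ Set.Ico r 1 from ⟨h, hw.2⟩)]
      · rw [if_neg (fun h' => h ((yy_le_iff hr hr1 hw.1 hw.2).1 h')),
          Set.indicator_of_notMem (fun h' => h h'.1)]
    rw [setIntegral_congr_fun measurableSet_Ioo h1, setIntegral_indicator measurableSet_Ico]
    have h2 : Set.Ioo (0:ℝ) 1 ∩ Set.Ico r 1 = Set.Ico r 1 := by
      apply Set.inter_eq_right.2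
      intro z hz
      exact ⟨lt_of_lt_of_le hr hz.1, hz.2⟩
    rw [h2, integral_Ico_eq_integral_Ioc, ← intervalIntegral.integral_of_le hr1,
      integral_inv_of_pos hr one_pos]
  · have : ∀ w ∈ Set.Ioo (0:ℝ) 1, kk y w = 0 := by
      intro w hw
      unfold kk
      rw [if_neg]
      intro h'
      exact h ⟨hy0, h'.trans (yy_le w)⟩
    rw [setIntegral_congr_fun measurableSet_Ioo this]
    simp

lemma yy_meas : Measurable yy := by unfold yy; fun_prop

lemma kk_meas : Measurable (Function.uncurry kk) := by
  unfold kk Function.uncurry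
  refine Measurable.ite ?_ (by fun_prop) measurable_const
  exact measurableSet_le (by fun_prop) (yy_meas.comp measurable_snd)

lemma kk_eq (w : ℝ) : (fun y => kk y w) =
    (Set.Icc (-yy w) (yy w)).indicator (fun _ => w⁻¹) := by
  funext y
  unfold kk
  simp only [Set.indicator, Set.mem_Icc, abs_le]

lemma kk_int : Integrable (Function.uncurry kk)
    ((volume : Measure ℝ).prod (volume.restrict (Set.Ioo (0:ℝ) 1))) := by
  rw [integrable_prod_iff' kk_meas.aestronglyMeasurable]
  constructor
  · refine Eventually.of_forall fun w => ?_
    simp only [Function.uncurry]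
    rw [kk_eq]
    rw [integrable_indicator_iff measurableSet_Icc]
    simp
  · have h : ∀ w ∈ Set.Ioo (0:ℝ) 1,
        (∫ y, ‖Function.uncurry kk (y, w)‖) = 2 / (1 + w ^ 2) := by
      intro w hw
      have h1 : ∀ y, ‖Function.uncurry kk (y, w)‖ =
          (Set.Icc (-yy w) (yy w)).indicator (fun _ => w⁻¹) y := by
        intro y
        rw [← kk_eq]
        simp only [Function.uncurry]
        apply Real.norm_of_nonneg
        unfold kk
        split_ifs
        · exact (inv_pos.2 hw.1).le
        · exact le_rfl
      simp_rw [h1]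
      rw [integral_indicator measurableSet_Icc, setIntegral_const]
      have := yy_pos hw.1
      rw [Real.volume_real_Icc_of_le (by linarith)]
      have hw0 := hw.1.ne'
      simp only [yy, smul_eq_mul]
      field_simp
      ring
    have h2 : IntegrableOn (fun w : ℝ => 2 / (1 + w ^ 2)) (Set.Ioo 0 1) := by
      have : Continuous (fun w : ℝ => 2 / (1 + w ^ 2)) := by
        refine continuous_const.div (by fun_prop) (fun w => by positivity)
      exact (this.continuousOn.integrableOn_Icc).mono_set Set.Ioo_subset_Icc_self
    exact h2.congr_fun (fun w hw => (h w hw).symm) measurableSet_Ioo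

lemma integral_frakF_mul {φ : ℝ → ℝ} (hφ : Measurable φ) {C : ℝ} (hC : ∀ y, ‖φ y‖ ≤ C) :
    ∫ y, frakF y * φ y =
      (2 / Real.pi) * ∫ w in Set.Ioo (0:ℝ) 1, w⁻¹ * ∫ y in (-yy w)..(yy w), φ y := by
  have h1 : ∫ y, frakF y * φ y =
      ∫ y, (2 / Real.pi) * ∫ w in Set.Ioo (0:ℝ) 1, kk y w * φ y := by
    apply integral_congr_ae
    have : ∀ᵐ y : ℝ, y ≠ 0 := by
      simp [ae_iff]
    filter_upwards [this] with y hy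
    rw [frakF_rep hy, integral_mul_const]
    ring
  rw [h1, integral_const_mul]
  congr 1
  have hint : Integrable (Function.uncurry fun y w => kk y w * φ y)
      ((volume : Measure ℝ).prod (volume.restrict (Set.Ioo (0:ℝ) 1))) := by
    exact kk_int.mul_bdd (c := C) (g := fun p : ℝ × ℝ => φ p.1)
      (hφ.comp measurable_fst).aestronglyMeasurable (Eventually.of_forall fun p => hC p.1)
  rw [integral_integral_swap hint]
  apply setIntegral_congr_fun measurableSet_Ioo
  intro w hw
  have := yy_pos hw.1
  have h2 : ∀ y, kk y w * φ y = (Set.Icc (-yy w) (yy w)).indicator (fun y => w⁻¹ * φ y) y := by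
    intro y
    have := congrFun (kk_eq w) y
    rw [this]
    simp only [Set.indicator]
    split_ifs <;> simp
  simp only [h2]
  rw [integral_indicator measurableSet_Icc, integral_Icc_eq_integral_Ioc,
    ← intervalIntegral.integral_of_le (by linarith), intervalIntegral.integral_const_mul]

lemma integral_frakF : ∫ y, frakF y = 1 := by
  have h := integral_frakF_mul (φ := fun _ => 1) measurable_const (C := 1) (by simp)
  simp only [mul_one] at h
  rw [h]
  have h1 : ∀ w ∈ Set.Ioo (0:ℝ) 1, w⁻¹ * ∫ y in (-yy w)..(yy w), (1:ℝ) = 2 * (1 + w ^ 2)⁻¹ := by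
    intro w hw
    have := hw.1.ne'
    rw [intervalIntegral.integral_const]
    simp only [yy, smul_eq_mul]
    field_simp
    ring
  rw [setIntegral_congr_fun measurableSet_Ioo h1, ← integral_Ioc_eq_integral_Ioo,
    ← intervalIntegral.integral_of_le zero_le_one, intervalIntegral.integral_const_mul,
    integral_inv_one_add_sq]
  simp
  field_simp
  norm_num

lemma frakF_nonneg (x : ℝ) : 0 ≤ frakF x := by
  unfold frakF
  split_ifs with h
  · have := Real.pi_pos
    refine mul_nonneg (by positivity) (Real.log_nonneg ?_)
    rw [le_div_iff₀ (by linarith [h.1])]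
    have := Real.sqrt_nonneg (1 - 4 * x ^ 2)
    linarith [h.2]
  · exact le_rfl

/-- truncated kernel -/
noncomputable def trk (ε t : ℝ) : ℝ := if ε ≤ |t| then t⁻¹ else 0

/-- truncated logarithm -/
noncomputable def trl (ε t : ℝ) : ℝ := Real.log (max |t| ε)

lemma trk_meas (ε : ℝ) : Measurable (trk ε) := by
  unfold trk
  refine Measurable.ite ?_ (by fun_prop) measurable_const
  exact measurableSet_le (by fun_prop) (by fun_prop)

lemma trk_bound {ε : ℝ} (hε : 0 < ε) (t : ℝ) : ‖trk ε t‖ ≤ ε⁻¹ := by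
  unfold trk
  split_ifs with h
  · rw [norm_inv, Real.norm_eq_abs]
    exact inv_anti₀ hε h
  · simp [hε.le]

lemma trl_cont {ε : ℝ} (hε : 0 < ε) : Continuous (trl ε) := by
  unfold trl
  refine Continuous.log (by fun_prop) (fun t => ?_)
  exact (lt_of_lt_of_le hε (le_max_right _ _)).ne'

lemma integral_trk {ε : ℝ} (hε : 0 < ε) (a b : ℝ) :
    ∫ t in a..b, trk ε t = trl ε b - trl ε a := by
  apply integral_eq_of_hasDerivAt_off_countable (trl ε) (trk ε) (s := {ε, -ε})
  · exact Set.Countable.insert _ (Set.countable_singleton _)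
  · exact (trl_cont hε).continuousOn
  · rintro x ⟨-, hx⟩
    simp only [Set.mem_insert_iff, Set.mem_singleton_iff, not_or] at hx
    have hne : |x| ≠ ε := by
      intro h
      rcases abs_choice x with h' | h'
      · exact hx.1 (by rw [← h', h])
      · exact hx.2 (by rw [← h, h']; ring)
    rcases lt_or_gt_of_ne hne with h | h
    · have h1 : trl ε =ᶠ[nhds x] fun _ => Real.log ε := by
        have : ∀ᶠ z in nhds x, |z| < ε := continuous_abs.continuousAt.eventually_lt_const h
        filter_upwards [this] with z hz
        simp [trl, max_eq_right hz.le]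
      have h2 : trk ε x = 0 := by simp [trk, h]
      rw [h2]
      exact (hasDerivAt_const x _).congr_of_eventuallyEq h1
    · have h1 : trl ε =ᶠ[nhds x] Real.log := by
        have : ∀ᶠ z in nhds x, ε < |z| := continuous_abs.continuousAt.eventually_const_lt h
        filter_upwards [this] with z hz
        simp [trl, max_eq_left hz.le]
      have h2 : trk ε x = x⁻¹ := by simp [trk, h.le]
      rw [h2]
      refine (Real.hasDerivAt_log ?_).congr_of_eventuallyEq h1
      rintro rfl
      simp at h
      linarith
  · have : IntegrableOn (trk ε) (Set.uIcc a b) := by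
      refine Measure.integrableOn_of_bounded (M := ε⁻¹) ?_ (trk_meas ε).aestronglyMeasurable
        (Eventually.of_forall (trk_bound hε))
      rw [Set.uIcc]
      simp
    exact this.intervalIntegrable

lemma trunc_formula {ε : ℝ} (hε : 0 < ε) (x : ℝ) :
    ∫ t in {t : ℝ | ε ≤ |t|}, frakF (x - t) / t =
      (2 / Real.pi) * ∫ w in Set.Ioo (0:ℝ) 1,
        w⁻¹ * (trl ε (x + yy w) - trl ε (x - yy w)) := by
  have hm : MeasurableSet {t : ℝ | ε ≤ |t|} := measurableSet_le (by fun_prop) (by fun_prop)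
  rw [← integral_indicator hm]
  have h1 : ∀ t, ({t : ℝ | ε ≤ |t|}).indicator (fun t => frakF (x - t) / t) t =
      (fun y => frakF y * trk ε (x - y)) (x - t) := by
    intro t
    simp only [Set.indicator, trk, Set.mem_ofPred_eq, sub_sub_cancel]
    split_ifs <;> simp [div_eq_mul_inv]
  simp_rw [h1]
  rw [integral_sub_left_eq_self (fun y => frakF y * trk ε (x - y)),
    integral_frakF_mul (φ := fun y => trk ε (x - y))
      ((trk_meas ε).comp (by fun_prop)) (C := ε⁻¹) (fun y => trk_bound hε _)]
  congr 2
  funext w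
  rw [intervalIntegral.integral_comp_sub_left (fun t => trk ε t), integral_trk hε]
  simp

/-- limiting integrand -/
noncomputable def gg (x w : ℝ) : ℝ := w⁻¹ * (Real.log |x + yy w| - Real.log |x - yy w|)

/-- auxiliary scale-invariant density -/
noncomputable def hh (v : ℝ) : ℝ := v⁻¹ * (Real.log (1 + v) - Real.log |1 - v|)

/-- integrand of the double integral -/
noncomputable def qq (b w : ℝ) : ℝ := 2 / (1 + w ^ 2 + 2 * w * b) + 2 / (1 + w ^ 2 - 2 * w * b)

lemma hh_nonneg {v : ℝ} (hv : 0 < v) : 0 ≤ hh v := by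
  unfold hh
  refine mul_nonneg (inv_pos.2 hv).le ?_
  by_cases h : v = 1
  · subst h; simp; exact Real.log_nonneg (by norm_num)
  · have : 0 < |1 - v| := abs_pos.2 (sub_ne_zero.2 (Ne.symm h))
    have := Real.log_le_log this (abs_le.2 ⟨by linarith, by linarith⟩ : |1 - v| ≤ 1 + v)
    linarith

lemma hh_meas : Measurable hh := by
  unfold hh
  fun_prop

lemma gg_meas (x : ℝ) : Measurable (gg x) := by
  unfold gg
  have := yy_meas
  fun_prop

lemma gg_nonneg {x w : ℝ} (hx : 0 < x) (hw : 0 < w) (hne : x ≠ yy w) : 0 ≤ gg x w := by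
  unfold gg
  have hy := yy_pos hw
  refine mul_nonneg (inv_pos.2 hw).le ?_
  have h0 : 0 < |x - yy w| := abs_pos.2 (sub_ne_zero.2 hne)
  rw [abs_of_pos (by linarith : 0 < x + yy w)]
  have := Real.log_le_log h0 (abs_le.2 ⟨by linarith, by linarith⟩ : |x - yy w| ≤ x + yy w)
  linarith

lemma denom_pos {b w : ℝ} (hb : |b| ≤ 1) (hw : 0 < w) (hw1 : w < 1) :
    0 < 1 + w ^ 2 + 2 * w * b ∧ 0 < 1 + w ^ 2 - 2 * w * b := by
  have := abs_le.1 hb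
  constructor <;> nlinarith [mul_pos (sub_pos.2 hw1) (sub_pos.2 hw1)]

lemma qq_int_b {c w : ℝ} (hc : 0 < c) (hc1 : c ≤ 1) (hw : 0 < w) (hw1 : w < 1) :
    ∫⁻ b in Set.Ioo 0 c, ENNReal.ofReal (qq b w) = ENNReal.ofReal (gg (1 / (2 * c)) w) := by
  have hd : ∀ b ∈ Set.Icc 0 c, 0 < 1 + w ^ 2 + 2 * w * b ∧ 0 < 1 + w ^ 2 - 2 * w * b := by
    intro b hb
    exact denom_pos (abs_le.2 ⟨by linarith [hb.1], hb.2.trans hc1⟩) hw hw1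
  have hcont : ContinuousOn (fun b => qq b w) (Set.Icc 0 c) := by
    unfold qq
    refine ContinuousOn.add ?_ ?_
    · exact continuousOn_const.div (by fun_prop) (fun b hb => (hd b hb).1.ne')
    · exact continuousOn_const.div (by fun_prop) (fun b hb => (hd b hb).2.ne')
  have hint : IntegrableOn (fun b => qq b w) (Set.Icc 0 c) := hcont.integrableOn_Icc
  have hnn : ∀ b ∈ Set.Icc 0 c, 0 ≤ qq b w := by
    intro b hb
    unfold qq
    have := hd b hb
    have h1 := this.1
    have h2 := this.2
    positivity
  rw [← ofReal_integral_eq_lintegral_ofReal (hint.mono_set Set.Ioo_subset_Icc_self)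
    ((ae_restrict_mem measurableSet_Ioo).mono fun b hb => hnn b (Set.Ioo_subset_Icc_self hb))]
  congr 1
  rw [← integral_Ioc_eq_integral_Ioo, ← intervalIntegral.integral_of_le hc.le]
  have hftc := intervalIntegral.integral_eq_sub_of_hasDerivAt_of_le hc.le
    (f := fun b => w⁻¹ * (Real.log (1 + w ^ 2 + 2 * w * b) - Real.log (1 + w ^ 2 - 2 * w * b)))
    (f' := fun b => qq b w) ?_ ?_ ?_
  · rw [hftc]
    simp only [mul_zero, add_zero, sub_zero, sub_self]
    unfold gg
    congr 1
    have hy := yy_pos hw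
    have h1 := (hd c ⟨hc.le, le_rfl⟩).1
    have h2 := (hd c ⟨hc.le, le_rfl⟩).2
    have e1 : 1 / (2 * c) + yy w = (1 + w ^ 2 + 2 * w * c) / (2 * c * (1 + w ^ 2)) := by
      unfold yy; field_simp
    have e2 : 1 / (2 * c) - yy w = (1 + w ^ 2 - 2 * w * c) / (2 * c * (1 + w ^ 2)) := by
      unfold yy; field_simp
    rw [e1, e2, abs_of_pos (by positivity), abs_of_pos (by positivity),
      Real.log_div h1.ne' (by positivity), Real.log_div h2.ne' (by positivity)]
    ring
  · refine ContinuousOn.mul continuousOn_const (ContinuousOn.sub ?_ ?_)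
    · exact ContinuousOn.log (by fun_prop) (fun b hb => (hd b hb).1.ne')
    · exact ContinuousOn.log (by fun_prop) (fun b hb => (hd b hb).2.ne')
  · intro b hb
    have h1 := (hd b (Set.Ioo_subset_Icc_self hb)).1
    have h2 := (hd b (Set.Ioo_subset_Icc_self hb)).2
    have d1 : HasDerivAt (fun b => 1 + w ^ 2 + 2 * w * b) (2 * w) b := by
      simpa using ((hasDerivAt_id b).const_mul (2 * w)).const_add (1 + w ^ 2)
    have d2 : HasDerivAt (fun b => 1 + w ^ 2 - 2 * w * b) (-(2 * w)) b := by
      simpa using ((hasDerivAt_id b).const_mul (2 * w)).const_sub (1 + w ^ 2)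
    refine (((d1.log h1.ne').sub (d2.log h2.ne')).const_mul w⁻¹).congr_deriv ?_
    unfold qq
    have h1' := h1.ne'
    have h2' := h2.ne'
    field_simp
    ring
  · rw [intervalIntegrable_iff_integrableOn_Icc_of_le hc.le]
    exact hint

lemma qq_int_w {b : ℝ} (hb : 0 < b) (hb1 : b < 1) :
    ∫⁻ w in Set.Ioo 0 1, ENNReal.ofReal (qq b w) =
      ENNReal.ofReal (Real.pi * (1 / Real.sqrt (1 - b ^ 2))) := by
  have hd : ∀ w : ℝ, 0 < 1 + w ^ 2 + 2 * w * b ∧ 0 < 1 + w ^ 2 - 2 * w * b := by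
    intro w
    constructor <;> nlinarith [sq_nonneg (w + b), sq_nonneg (w - b)]
  have hcont : Continuous (fun w => qq b w) := by
    unfold qq
    refine Continuous.add ?_ ?_
    · exact continuous_const.div (by fun_prop) (fun w => (hd w).1.ne')
    · exact continuous_const.div (by fun_prop) (fun w => (hd w).2.ne')
  have hint : IntegrableOn (fun w => qq b w) (Set.Icc 0 1) := hcont.continuousOn.integrableOn_Icc
  have hnn : ∀ w, 0 ≤ qq b w := by
    intro w
    unfold qq
    have h1 := (hd w).1
    have h2 := (hd w).2
    positivity
  rw [← ofReal_integral_eq_lintegral_ofReal (hint.mono_set Set.Ioo_subset_Icc_self)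
    (Eventually.of_forall hnn)]
  congr 1
  rw [← integral_Ioc_eq_integral_Ioo, ← intervalIntegral.integral_of_le zero_le_one]
  set s := Real.sqrt (1 - b ^ 2) with hs
  have hpos : 0 < 1 - b ^ 2 := by nlinarith
  have hs0 : 0 < s := Real.sqrt_pos.2 hpos
  have hss : s ^ 2 = 1 - b ^ 2 := Real.sq_sqrt hpos.le
  have hder : ∀ w ∈ Set.uIcc (0:ℝ) 1, HasDerivAt
      (fun w => (2 / s) * (Real.arctan ((w + b) / s) + Real.arctan ((w - b) / s))) (qq b w) w := by
    intro w _
    have d1 : HasDerivAt (fun w => (w + b) / s) (1 / s) w :=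
      ((hasDerivAt_id w).add_const b).div_const s
    have d2 : HasDerivAt (fun w => (w - b) / s) (1 / s) w :=
      ((hasDerivAt_id w).sub_const b).div_const s
    refine ((d1.arctan.add d2.arctan).const_mul (2 / s)).congr_deriv ?_
    have e1 : 1 + ((w + b) / s) ^ 2 = (1 + w ^ 2 + 2 * w * b) / s ^ 2 := by
      field_simp
      rw [hss]; ring
    have e2 : 1 + ((w - b) / s) ^ 2 = (1 + w ^ 2 - 2 * w * b) / s ^ 2 := by
      field_simp
      rw [hss]; ring
    rw [e1, e2]
    unfold qq
    have h1' := (hd w).1.ne'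
    have h2' := (hd w).2.ne'
    field_simp
  rw [intervalIntegral.integral_eq_sub_of_hasDerivAt hder (hcont.intervalIntegrable _ _)]
  have e : (1 - b) / s = ((1 + b) / s)⁻¹ := by
    have : 0 < 1 + b := by linarith
    field_simp
    rw [hss]; ring
  rw [e, Real.arctan_inv_of_pos (by positivity)]
  have e3 : (0 - b) / s = - ((0 + b) / s) := by ring
  rw [e3, Real.arctan_neg]
  field_simp
  ring

lemma lint_ext {c : ℝ} (hc : 0 < c) (hc1 : c ≤ 1) :
    ∫⁻ w in Set.Ioo 0 1, ENNReal.ofReal (gg (1 / (2 * c)) w) =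
      ENNReal.ofReal (Real.pi * Real.arcsin c) := by
  rw [← setLIntegral_congr_fun measurableSet_Ioo
    (fun w hw => qq_int_b hc hc1 hw.1 hw.2)]
  rw [lintegral_lintegral_swap]
  · rw [setLIntegral_congr_fun measurableSet_Ioo
      (fun b hb => qq_int_w hb.1 (lt_of_lt_of_le hb.2 hc1))]
    have hcont : ContinuousOn Real.arcsin (Set.Icc 0 c) := Real.continuous_arcsin.continuousOn
    have hder : ∀ b ∈ Set.Ioo 0 c, HasDerivAt Real.arcsin (1 / Real.sqrt (1 - b ^ 2)) b := by
      intro b hb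
      exact Real.hasDerivAt_arcsin (by linarith [hb.1]) (by linarith [hb.2])
    have hint := intervalIntegral.integrableOn_deriv_of_nonneg hcont hder
      (fun b _ => by positivity)
    rw [← ofReal_integral_eq_lintegral_ofReal
      ((hint.mono_set Set.Ioo_subset_Ioc_self).const_mul _)
      (Eventually.of_forall fun b => by have := Real.pi_pos; positivity)]
    congr 1
    rw [integral_const_mul, ← integral_Ioc_eq_integral_Ioo,
      ← intervalIntegral.integral_of_le hc.le,
      intervalIntegral.integral_eq_sub_of_hasDerivAt_of_le hc.le hcont hder
        ((intervalIntegrable_iff_integrableOn_Ioc_of_le hc.le).2 hint)]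
    simp
  · unfold qq Function.uncurry
    apply Measurable.aemeasurable
    fun_prop

lemma lint_scale {r : ℝ} (hr : 0 < r) :
    ∫⁻ w in Set.Ioo 0 1, ENNReal.ofReal (r * hh (r * w)) =
      ∫⁻ v in Set.Ioo 0 r, ENNReal.ofReal (hh v) := by
  have h := lintegral_image_eq_lintegral_abs_deriv_mul (s := Set.Ioo (0:ℝ) 1)
    (f := fun w => r * w) (f' := fun _ => r) measurableSet_Ioo
    (fun w _ => by simpa using ((hasDerivAt_id w).const_mul r).hasDerivWithinAt)
    (fun a _ b _ hab => mul_left_cancel₀ hr.ne' hab) (fun v => ENNReal.ofReal (hh v))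
  have himg : (fun w => r * w) '' Set.Ioo (0:ℝ) 1 = Set.Ioo 0 r := by
    rw [Set.image_mul_left_Ioo hr]; simp
  rw [himg] at h
  rw [h]
  apply setLIntegral_congr_fun measurableSet_Ioo
  intro w hw
  simp only [abs_of_pos hr]
  rw [ENNReal.ofReal_mul hr.le]

lemma hh_inv {v : ℝ} (hv : 0 < v) : hh v⁻¹ = v ^ 2 * hh v := by
  by_cases h1 : v = 1
  · subst h1; simp
  unfold hh
  have e1 : 1 + v⁻¹ = (1 + v) / v := by field_simp; ring
  have e2 : |1 - v⁻¹| = |1 - v| / v := by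
    have : 1 - v⁻¹ = -(1 - v) / v := by field_simp; ring
    rw [this, abs_div, abs_neg, abs_of_pos hv]
  have h0 : |1 - v| ≠ 0 := abs_ne_zero.2 (sub_ne_zero.2 (Ne.symm h1))
  rw [e1, e2, Real.log_div (by positivity) hv.ne', Real.log_div h0 hv.ne']
  field_simp
  ring

lemma lint_inv {r : ℝ} (hr : 0 < r) :
    ∫⁻ w in Set.Ioo 0 1, ENNReal.ofReal (r⁻¹ * hh (w / r)) =
      ∫⁻ v in Set.Ioi r, ENNReal.ofReal (hh v) := by
  have h := lintegral_image_eq_lintegral_abs_deriv_mul (s := Set.Ioo (0:ℝ) 1)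
    (f := fun w => r * w⁻¹) (f' := fun w => r * (-(w ^ 2)⁻¹)) measurableSet_Ioo
    (fun w hw => ((hasDerivAt_inv hw.1.ne').const_mul r).hasDerivWithinAt)
    (fun a _ b _ hab => inv_injective (mul_left_cancel₀ hr.ne' hab))
    (fun v => ENNReal.ofReal (hh v))
  have himg : (fun w => r * w⁻¹) '' Set.Ioo (0:ℝ) 1 = Set.Ioi r := by
    ext v
    simp only [Set.mem_image, Set.mem_Ioi, Set.mem_Ioo]
    constructor
    · rintro ⟨w, ⟨h0, h1⟩, rfl⟩
      have := (one_lt_inv₀ h0).2 h1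
      nlinarith
    · intro hv
      have hv0 : 0 < v := hr.trans hv
      refine ⟨r / v, ⟨by positivity, (div_lt_one hv0).2 hv⟩, ?_⟩
      field_simp
  rw [himg] at h
  rw [h]
  apply setLIntegral_congr_fun measurableSet_Ioo
  intro w hw
  have hw0 := hw.1
  have hwr : 0 < w / r := by positivity
  simp only
  rw [← ENNReal.ofReal_mul (abs_nonneg _)]
  congr 1
  have e : r * w⁻¹ = (w / r)⁻¹ := by rw [inv_div]; rfl
  rw [e, hh_inv hwr, mul_neg, abs_neg, abs_of_pos (by positivity)]
  field_simp

lemma gg_eq {r w : ℝ} (hr : 0 < r) (hr1 : r ≤ 1) (hw : 0 < w) (hw1 : w < 1) (hne : w ≠ r) :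
    gg (yy r) w = r⁻¹ * hh (w / r) + r * hh (r * w) := by
  unfold gg hh
  have hrw : 0 < 1 - r * w := by nlinarith
  have h0 : r - w ≠ 0 := sub_ne_zero.2 (Ne.symm hne)
  have e1 : |yy r + yy w| = ((r + w) * (1 + r * w)) / ((1 + r ^ 2) * (1 + w ^ 2)) := by
    rw [abs_of_pos (add_pos (yy_pos hr) (yy_pos hw))]
    unfold yy; field_simp; ring
  have e2 : |yy r - yy w| = (|r - w| * (1 - r * w)) / ((1 + r ^ 2) * (1 + w ^ 2)) := by
    have : yy r - yy w = ((r - w) * (1 - r * w)) / ((1 + r ^ 2) * (1 + w ^ 2)) := by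
      unfold yy; field_simp; ring
    rw [this, abs_div, abs_mul, abs_of_pos hrw,
      abs_of_pos (by positivity : 0 < (1 + r ^ 2) * (1 + w ^ 2))]
  have h0' : |r - w| ≠ 0 := abs_ne_zero.2 h0
  have e3 : 1 + w / r = (r + w) / r := by field_simp
  have e4 : |1 - w / r| = |r - w| / r := by
    have : 1 - w / r = (r - w) / r := by field_simp
    rw [this, abs_div, abs_of_pos hr]
  have hrw' := hrw.ne'
  rw [e1, e2, e3, e4, abs_of_pos hrw, Real.log_div (by positivity) (by positivity),
    Real.log_div (by positivity) (by positivity), Real.log_div (by positivity) (by positivity),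
    Real.log_div (by positivity) (by positivity),
    Real.log_mul (by positivity : r + w ≠ 0) (by positivity), Real.log_mul h0' hrw']
  field_simp
  ring

lemma ae_ne (r : ℝ) (s : Set ℝ) : ∀ᵐ w ∂(volume.restrict s), w ≠ r :=
  ae_restrict_of_ae (by simp [ae_iff])

lemma lint_int {r : ℝ} (hr : 0 < r) (hr1 : r ≤ 1) :
    ∫⁻ w in Set.Ioo 0 1, ENNReal.ofReal (gg (yy r) w) =
      ∫⁻ v in Set.Ioi 0, ENNReal.ofReal (hh v) := by
  have h1 : ∫⁻ w in Set.Ioo 0 1, ENNReal.ofReal (gg (yy r) w) =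
      ∫⁻ w in Set.Ioo 0 1, (ENNReal.ofReal (r⁻¹ * hh (w / r)) + ENNReal.ofReal (r * hh (r * w))) := by
    apply lintegral_congr_ae
    filter_upwards [ae_restrict_mem measurableSet_Ioo, ae_ne r (Set.Ioo 0 1)] with w hw hne
    have hw0 := hw.1
    rw [gg_eq hr hr1 hw.1 hw.2 hne, ENNReal.ofReal_add]
    · exact mul_nonneg (by positivity) (hh_nonneg (by positivity))
    · exact mul_nonneg (by positivity) (hh_nonneg (by positivity))
  have hm := hh_meas
  rw [h1, lintegral_add_left (by fun_prop), lint_scale hr, lint_inv hr,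
    ← Set.Ioc_union_Ioi_eq_Ioi hr.le, lintegral_union measurableSet_Ioi,
    add_comm]
  · congr 1
    exact setLIntegral_congr Ioo_ae_eq_Ioc
  · exact Set.disjoint_left.2 fun z hz hzz => absurd hz.2 (not_le.2 hzz)

/-- the value -/
noncomputable def vv (x : ℝ) : ℝ :=
  if x < 1/2 then Real.pi * (Real.pi / 2) else Real.pi * Real.arcsin (1 / (2 * x))

lemma lint_val {x : ℝ} (hx : 0 < x) :
    ∫⁻ w in Set.Ioo 0 1, ENNReal.ofReal (gg x w) = ENNReal.ofReal (vv x) := by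
  unfold vv
  split_ifs with h
  · obtain ⟨r, hr, hr1, hu, -⟩ := exists_r hx h.le
    rw [hu, lint_int hr hr1, ← lint_int one_pos le_rfl]
    have := lint_ext one_pos le_rfl
    rw [Real.arcsin_one] at this
    rw [← this]
    have e : yy 1 = 1 / (2 * 1) := by unfold yy; norm_num
    rw [e]
  · push Not at h
    have := lint_ext (c := 1 / (2 * x)) (by positivity) (by
      rw [div_le_one (by positivity)]; linarith)
    rw [← this]
    have e : 1 / (2 * (1 / (2 * x))) = x := by field_simp
    rw [e]

lemma ae_yy_ne (x : ℝ) : ∀ᵐ w ∂(volume.restrict (Set.Ioo (0:ℝ) 1)), x ≠ yy w := by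
  by_cases h : 0 < x ∧ x ≤ 1/2
  · obtain ⟨r, hr, hr1, hu, -⟩ := exists_r h.1 h.2
    filter_upwards [ae_restrict_mem measurableSet_Ioo, ae_ne r (Set.Ioo 0 1)] with w hw hne he
    rw [hu] at he
    apply hne
    apply le_antisymm _ ((yy_le_iff hr hr1 hw.1 hw.2).1 he.le)
    by_contra h3
    push Not at h3
    have h : r * (1 + w ^ 2) - w * (1 + r ^ 2) = (r - w) * (1 - r * w) := by ring
    have h1 : 0 < 1 - r * w := by nlinarith [hw.1, hw.2]
    unfold yy at he
    rw [div_eq_div_iff (by positivity) (by positivity)] at he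
    have := mul_pos (sub_pos.2 h3) h1
    nlinarith
  · filter_upwards [ae_restrict_mem measurableSet_Ioo] with w hw he
    exact h ⟨he ▸ yy_pos hw.1, he ▸ yy_le w⟩

lemma gg_ae_nonneg {x : ℝ} (hx : 0 < x) :
    0 ≤ᵐ[volume.restrict (Set.Ioo (0:ℝ) 1)] gg x := by
  filter_upwards [ae_restrict_mem measurableSet_Ioo, ae_yy_ne x] with w hw hne
  exact gg_nonneg hx hw.1 hne

lemma vv_nonneg {x : ℝ} (hx : 0 < x) : 0 ≤ vv x := by
  unfold vv
  have := Real.pi_pos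
  split_ifs
  · positivity
  · exact mul_nonneg this.le (Real.arcsin_nonneg.2 (by positivity))

lemma gg_integrable {x : ℝ} (hx : 0 < x) : IntegrableOn (gg x) (Set.Ioo 0 1) := by
  rw [IntegrableOn, ← lintegral_ofReal_ne_top_iff_integrable (gg_meas x).aestronglyMeasurable
    (gg_ae_nonneg hx), lint_val hx]
  exact ENNReal.ofReal_ne_top

lemma gg_integral {x : ℝ} (hx : 0 < x) : ∫ w in Set.Ioo 0 1, gg x w = vv x := by
  rw [integral_eq_lintegral_of_nonneg_ae (gg_ae_nonneg hx) (gg_meas x).aestronglyMeasurable,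
    lint_val hx, ENNReal.toReal_ofReal (vv_nonneg hx)]

lemma trl_diff {ε a b : ℝ} (hε : 0 < ε) (hb : 0 < |b|) (hab : |b| ≤ |a|) :
    0 ≤ trl ε a - trl ε b ∧ trl ε a - trl ε b ≤ Real.log |a| - Real.log |b| := by
  unfold trl
  have ha : 0 < |a| := hb.trans_le hab
  constructor
  · have := Real.log_le_log (lt_max_of_lt_left hb) (max_le_max_right ε hab)
    linarith
  · rcases le_total |a| ε with h | h
    · rw [max_eq_right h, max_eq_right (hab.trans h), sub_self]
      linarith [Real.log_le_log hb hab]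
    · rw [max_eq_left h]
      have := Real.log_le_log hb (le_max_left |b| ε)
      linarith

lemma tendsto_trl {t : ℝ} (ht : t ≠ 0) :
    Tendsto (fun ε => trl ε t) (nhdsWithin 0 (Set.Ioi 0)) (nhds (Real.log |t|)) := by
  apply tendsto_const_nhds.congr'
  have : ∀ᶠ ε in nhdsWithin (0:ℝ) (Set.Ioi 0), ε < |t| :=
    nhdsWithin_le_nhds (eventually_lt_nhds (abs_pos.2 ht))
  filter_upwards [this] with ε h
  simp [trl, max_eq_left h.le]

lemma tendsto_pos {x : ℝ} (hx : 0 < x) :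
    Tendsto (fun ε => ∫ w in Set.Ioo (0:ℝ) 1, w⁻¹ * (trl ε (x + yy w) - trl ε (x - yy w)))
      (nhdsWithin 0 (Set.Ioi 0)) (nhds (vv x)) := by
  rw [← gg_integral hx]
  apply tendsto_integral_filter_of_dominated_convergence (gg x)
  · filter_upwards [self_mem_nhdsWithin] with ε hε
    have h1 := (trl_cont hε).measurable
    have := yy_meas
    apply Measurable.aestronglyMeasurable
    fun_prop
  · filter_upwards [self_mem_nhdsWithin] with ε hε
    filter_upwards [ae_restrict_mem measurableSet_Ioo, ae_yy_ne x] with w hw hne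
    have hy := yy_pos hw.1
    have hw' := inv_pos.2 hw.1
    have h0 : 0 < |x - yy w| := abs_pos.2 (sub_ne_zero.2 hne)
    have := trl_diff (a := x + yy w) hε h0 (by
      rw [abs_of_pos (by linarith : 0 < x + yy w)]
      exact abs_le.2 ⟨by linarith, by linarith⟩)
    rw [Real.norm_of_nonneg (mul_nonneg hw'.le this.1)]
    exact mul_le_mul_of_nonneg_left this.2 hw'.le
  · exact gg_integrable hx
  · filter_upwards [ae_restrict_mem measurableSet_Ioo, ae_yy_ne x] with w hw hne
    have hy := yy_pos hw.1
    exact ((tendsto_trl (by linarith)).sub (tendsto_trl (sub_ne_zero.2 hne))).const_mul _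

lemma pv_pos {x : ℝ} (hx : 0 < x) :
    pvHilbAt frakF x ((1 / Real.pi) * ((2 / Real.pi) * vv x)) := by
  unfold pvHilbAt
  refine (((tendsto_pos hx).const_mul (2 / Real.pi)).const_mul (1 / Real.pi)).congr' ?_
  filter_upwards [self_mem_nhdsWithin] with ε hε
  rw [trunc_formula hε]

lemma trl_neg (ε t : ℝ) : trl ε (-t) = trl ε t := by simp [trl]

lemma pv_neg {x : ℝ} (hx : 0 < x) :
    pvHilbAt frakF (-x) (-((1 / Real.pi) * ((2 / Real.pi) * vv x))) := by
  unfold pvHilbAt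
  refine (((tendsto_pos hx).const_mul (2 / Real.pi)).const_mul (1 / Real.pi)).neg.congr' ?_
  filter_upwards [self_mem_nhdsWithin] with ε hε
  rw [trunc_formula hε, ← mul_neg, ← mul_neg, ← integral_neg]
  congr 3
  funext w
  rw [← trl_neg ε (-x + yy w), ← trl_neg ε (-x - yy w),
    show -(-x + yy w) = x - yy w by ring, show -(-x - yy w) = x + yy w by ring]
  ring

/-- the claimed Hilbert transform -/
noncomputable def claim (x : ℝ) : ℝ :=
  if |x| < 1/2 then Real.sign x else (2 / Real.pi) * Real.arcsin (1 / (2 * x))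

lemma vv_claim {x : ℝ} (hx : 0 < x) : (1 / Real.pi) * ((2 / Real.pi) * vv x) = claim x := by
  unfold vv claim
  have := Real.pi_pos
  rw [abs_of_pos hx, Real.sign_of_pos hx]
  split_ifs
  · field_simp
  · field_simp

lemma claim_neg (x : ℝ) : claim (-x) = - claim x := by
  unfold claim
  rw [abs_neg, Real.sign_neg, mul_neg, div_neg, Real.arcsin_neg]
  split_ifs <;> simp

lemma pv_claim {x : ℝ} (hx : x ≠ 0) : pvHilbAt frakF x (claim x) := by
  rcases lt_or_gt_of_ne hx with h | h
  · have := pv_neg (x := -x) (by linarith)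
    rwa [vv_claim (by linarith), claim_neg, neg_neg, neg_neg] at this
  · have := pv_pos h
    rwa [vv_claim h] at this

lemma claim_le (x : ℝ) : ‖claim x‖ ≤ 1 := by
  unfold claim
  have hp := Real.pi_pos
  rw [Real.norm_eq_abs]
  split_ifs
  · rcases Real.sign_apply_eq x with h | h | h <;> simp [h]
  · rw [abs_mul, abs_of_pos (by positivity)]
    have : |Real.arcsin (1 / (2 * x))| ≤ Real.pi / 2 :=
      abs_le.2 ⟨Real.neg_pi_div_two_le_arcsin _, Real.arcsin_le_pi_div_two _⟩
    calc 2 / Real.pi * |Real.arcsin (1 / (2 * x))| ≤ 2 / Real.pi * (Real.pi / 2) :=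
          mul_le_mul_of_nonneg_left this (by positivity)
      _ = 1 := by field_simp

lemma norm_eq_one {G : ℝ → ℝ} (hG : ∀ᵐ x ∂(volume : Measure ℝ), pvHilbAt frakF x (G x)) :
    eLpNorm G ⊤ volume = 1 := by
  have h0 : ∀ᵐ x : ℝ, x ≠ 0 := by simp [ae_iff]
  have hGc : G =ᵐ[volume] claim := by
    filter_upwards [hG, h0] with x hx hx0
    exact tendsto_nhds_unique hx (pv_claim hx0)
  rw [eLpNorm_congr_ae hGc, eLpNorm_exponent_top]
  apply le_antisymm
  · simpa using eLpNormEssSup_le_of_ae_bound (μ := volume) (f := claim) (C := 1)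
      (Eventually.of_forall claim_le)
  · by_contra hlt
    have hae := ae_le_eLpNormEssSup (μ := volume) (f := claim)
    have : ∀ᵐ x : ℝ, x ∉ Set.Ioo (0:ℝ) (1/2) := by
      filter_upwards [hae] with x hx hmem
      apply hlt
      have e : claim x = 1 := by
        unfold claim
        rw [abs_of_pos hmem.1, if_pos hmem.2, Real.sign_of_pos hmem.1]
      rw [e] at hx
      simpa using hx
    rw [ae_iff] at this
    simp only [not_not, Set.ofPred_mem_eq, Real.volume_Ioo] at this
    norm_num at this

/-- `𝔉 ≥ 0`, `∫𝔉 = 1`, the principal value limit defining `𝓗(𝔉)(x)` exists for every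
`x ∉ {0, ±1/2}` and equals `sgn(x)` for `0 < |x| < 1/2` and `(2/π)·arcsin(1/(2x))` for
`|x| > 1/2`; in particular the essential supremum of `|𝓗(𝔉)|` over `ℝ` equals `1`. -/
theorem stmt15 :
    (∀ x : ℝ, 0 ≤ frakF x) ∧
    (∫ x : ℝ, frakF x) = 1 ∧
    (∀ x : ℝ, x ≠ 0 → |x| ≠ 1/2 →
      pvHilbAt frakF x
        (if |x| < 1/2 then Real.sign x else (2 / Real.pi) * Real.arcsin (1 / (2 * x)))) ∧
    (∀ G : ℝ → ℝ, (∀ᵐ x ∂(volume : Measure ℝ), pvHilbAt frakF x (G x)) →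
      eLpNorm G ⊤ volume = 1) := by
  exact ⟨frakF_nonneg, integral_frakF, fun x hx _ => pv_claim hx, fun G hG => norm_eq_one hG⟩
end
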